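/- arXiv:1902.06473 — 6 statements merged into one kernel-verified Lean document; each statement's English description precedes it below -/
import Mathlib

section
/- Let P be a partially ordered set on the ground set [n] = {1,...,n}. Stanley's transfer map d, defined for a point y in the order polytope O(P) by d_i(y) = y_i if i is a minimal element of P, and d_i(y) = min{ y_i - y_j : j ≠ i, j ≤_P i } otherwise, is a bijection from the order polytope O(P) onto the chain polytope C(P). -/
open MeasureTheory Finset

attribute [local instance] Classical.propDecidable

noncomputable def harm (q : ℕ) : ℝ := ∑ m ∈ Finset.range q, (1 : ℝ) / (m + 1)

noncomputable def linExts (α : Type) [Fintype α] (r : α → α → Prop) :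
    Finset (α ≃ Fin (Fintype.card α)) :=
  Finset.univ.filter fun σ => ∀ i j : α, r i j → σ i ≤ σ j

noncomputable def dN {α : Type} [Fintype α] (r : α → α → Prop)
    (σ : α ≃ Fin (Fintype.card α)) (i : α) : ℕ :=
  if ∀ j : α, r j i → j = i then (σ i : ℕ) + 1
  else sInf {m : ℕ | ∃ j : α, j ≠ i ∧ r j i ∧ m = (σ i : ℕ) - (σ j : ℕ)}

noncomputable def QLB (α : Type) [Fintype α] (r : α → α → Prop) : ℝ :=
  (∑ σ ∈ linExts α r, ∑ i : α, harm (dN r σ i - 1)) / ((linExts α r).card : ℝ)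

def chainPolytope (α : Type) [Fintype α] (r : α → α → Prop) : Set (α → ℝ) :=
  {y | (∀ i, 0 ≤ y i) ∧
    ∀ C : Finset α, (∀ i ∈ C, ∀ j ∈ C, r i j ∨ r j i) → ∑ i ∈ C, y i ≤ 1}

def orderPolytope (α : Type) [Fintype α] (r : α → α → Prop) : Set (α → ℝ) :=
  {y | (∀ i, 0 ≤ y i ∧ y i ≤ 1) ∧ ∀ i j : α, r i j → y i ≤ y j}

noncomputable def transferMap (α : Type) [Fintype α] (r : α → α → Prop)
    (y : α → ℝ) (i : α) : ℝ :=
  if ∀ j : α, r j i → j = i then y i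
  else sInf {t : ℝ | ∃ j : α, j ≠ i ∧ r j i ∧ t = y i - y j}

noncomputable def QH (α : Type) [Fintype α] (r : α → α → Prop) : ℝ :=
  ⨍ z in chainPolytope α r, -(1 / (Fintype.card α : ℝ)) * ∑ i : α, Real.log (z i)

noncomputable def posetEntropy (α : Type) [Fintype α] (r : α → α → Prop) : ℝ :=
  sInf {x : ℝ | ∃ z ∈ chainPolytope α r, (∀ i, 0 < z i) ∧
    x = -(1 / (Fintype.card α : ℝ)) * ∑ i : α, Real.log (z i)}

def seriesComp {α β : Type} (r : α → α → Prop) (s : β → β → Prop) :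
    α ⊕ β → α ⊕ β → Prop
  | Sum.inl x, Sum.inl y => r x y
  | Sum.inr x, Sum.inr y => s x y
  | Sum.inl _, Sum.inr _ => True
  | Sum.inr _, Sum.inl _ => False

def parallelComp {α β : Type} (r : α → α → Prop) (s : β → β → Prop) :
    α ⊕ β → α ⊕ β → Prop
  | Sum.inl x, Sum.inl y => r x y
  | Sum.inr x, Sum.inr y => s x y
  | _, _ => False

theorem exists_greatest_of_chain {α : Type} {r : α → α → Prop} [IsPartialOrder α r]
    (C : Finset α) (hne : C.Nonempty) (hC : ∀ i ∈ C, ∀ j ∈ C, r i j ∨ r j i) :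
    ∃ m ∈ C, ∀ j ∈ C, r j m := by
  induction hne using Finset.Nonempty.cons_induction with
  | singleton a => exact ⟨a, by simp, by simpa using refl_of r a⟩
  | cons a s ha hs ih =>
    obtain ⟨m, hm, hmax⟩ := ih fun i hi j hj =>
      hC i (Finset.mem_cons_of_mem hi) j (Finset.mem_cons_of_mem hj)
    rcases hC a (Finset.mem_cons_self a s) m (Finset.mem_cons_of_mem hm) with h | h
    · refine ⟨m, Finset.mem_cons_of_mem hm, fun j hj => ?_⟩
      rcases Finset.mem_cons.1 hj with rfl | hj
      exacts [h, hmax j hj]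
    · refine ⟨a, Finset.mem_cons_self a s, fun j hj => ?_⟩
      rcases Finset.mem_cons.1 hj with rfl | hj
      exacts [refl_of r j, trans_of r (hmax j hj) h]

/-- Among the chains lying below `i`, one has the largest `z`-weight. -/
theorem exists_isGreatest_chain_sum {α : Type} [Fintype α] (r : α → α → Prop) (z : α → ℝ) (i : α) :
    ∃ s, IsGreatest {t : ℝ | ∃ C : Finset α, (∀ a ∈ C, ∀ b ∈ C, r a b ∨ r b a) ∧
      (∀ a ∈ C, r a i) ∧ ∑ a ∈ C, z a = t} s := by
  have hfin : {t : ℝ | ∃ C : Finset α, (∀ a ∈ C, ∀ b ∈ C, r a b ∨ r b a) ∧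
      (∀ a ∈ C, r a i) ∧ ∑ a ∈ C, z a = t}.Finite := by
    refine (Set.finite_range fun C : Finset α => ∑ a ∈ C, z a).subset ?_
    rintro t ⟨C, -, -, e⟩
    exact ⟨C, e⟩
  exact ⟨_, Set.Nonempty.csSup_mem ⟨0, ∅, by simp, by simp, by simp⟩ hfin,
    fun t ht => le_csSup hfin.bddAbove ht⟩

section TransferMap

variable {α : Type} [Fintype α] {r : α → α → Prop}

theorem transferMap_of_minimal {i : α} (h : ∀ j, r j i → j = i) (y : α → ℝ) :
    transferMap α r y i = y i :=
  if_pos h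

theorem isLeast_transferMap {i : α} (h : ¬ ∀ j, r j i → j = i) (y : α → ℝ) :
    IsLeast {t : ℝ | ∃ j : α, j ≠ i ∧ r j i ∧ t = y i - y j} (transferMap α r y i) := by
  have hfin : {t : ℝ | ∃ j : α, j ≠ i ∧ r j i ∧ t = y i - y j}.Finite := by
    refine (Set.finite_range fun j => y i - y j).subset ?_
    rintro t ⟨j, -, -, rfl⟩
    exact ⟨j, rfl⟩
  have hne : {t : ℝ | ∃ j : α, j ≠ i ∧ r j i ∧ t = y i - y j}.Nonempty := by
    push Not at h
    obtain ⟨j, hj, hji⟩ := h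
    exact ⟨_, j, hji, hj, rfl⟩
  rw [transferMap, if_neg h]
  exact ⟨hne.csInf_mem hfin, fun t ht => csInf_le hfin.bddBelow ht⟩

theorem transferMap_le_sub {i j : α} (hne : j ≠ i) (hji : r j i) (y : α → ℝ) :
    transferMap α r y i ≤ y i - y j :=
  (isLeast_transferMap (fun h => hne (h j hji)) y).2 ⟨j, hne, hji, rfl⟩

theorem transferMap_nonneg {y : α → ℝ} (hy : y ∈ orderPolytope α r) (i : α) :
    0 ≤ transferMap α r y i := by
  by_cases h : ∀ j, r j i → j = i
  · rw [transferMap_of_minimal h]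
    exact (hy.1 i).1
  · obtain ⟨j, -, hji, e⟩ := (isLeast_transferMap h y).1
    rw [e]
    exact sub_nonneg.2 (hy.2 j i hji)

theorem transferMap_le_self {y : α → ℝ} (hy : ∀ i, 0 ≤ y i) (i : α) :
    transferMap α r y i ≤ y i := by
  by_cases h : ∀ j, r j i → j = i
  · rw [transferMap_of_minimal h]
  · obtain ⟨j, -, -, e⟩ := (isLeast_transferMap h y).1
    rw [e]
    exact sub_le_self _ (hy j)

variable [IsPartialOrder α r]

theorem sum_transferMap_le {y : α → ℝ} (hy : y ∈ orderPolytope α r) (C : Finset α)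
    (hC : ∀ i ∈ C, ∀ j ∈ C, r i j ∨ r j i) (i : α) (hi : ∀ j ∈ C, r j i) :
    ∑ j ∈ C, transferMap α r y j ≤ y i := by
  induction C using Finset.strongInduction generalizing i with
  | H C ih =>
    rcases C.eq_empty_or_nonempty with rfl | hne
    · simpa using (hy.1 i).1
    obtain ⟨m, hm, hmax⟩ := exists_greatest_of_chain C hne hC
    have hC' : ∀ a ∈ C.erase m, ∀ b ∈ C.erase m, r a b ∨ r b a := fun a ha b hb =>
      hC a (Finset.mem_of_mem_erase ha) b (Finset.mem_of_mem_erase hb)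
    have hmi := hy.2 m i (hi m hm)
    rw [← Finset.add_sum_erase C _ hm]
    rcases (C.erase m).eq_empty_or_nonempty with he | hne'
    · rw [he, Finset.sum_empty, add_zero]
      exact (transferMap_le_self (fun i => (hy.1 i).1) m).trans hmi
    · obtain ⟨k, hk, hkmax⟩ := exists_greatest_of_chain _ hne' hC'
      have h₁ := ih _ (Finset.erase_ssubset hm) hC' k hkmax
      have h₂ := transferMap_le_sub (Finset.ne_of_mem_erase hk)
        (hmax k (Finset.mem_of_mem_erase hk)) y
      linarith

theorem transferMap_mapsTo :
    Set.MapsTo (transferMap α r) (orderPolytope α r) (chainPolytope α r) := by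
  refine fun y hy => ⟨transferMap_nonneg hy, fun C hC => ?_⟩
  rcases C.eq_empty_or_nonempty with rfl | hne
  · simp
  · obtain ⟨m, -, hmax⟩ := exists_greatest_of_chain C hne hC
    exact (sum_transferMap_le hy C hC m hmax).trans (hy.1 m).2

theorem transferMap_injective : Function.Injective (transferMap α r) := by
  intro y y' h
  have hwf : WellFounded fun a b : α => a ≠ b ∧ r a b :=
    haveI : IsTrans α fun a b => a ≠ b ∧ r a b := ⟨fun a b c hab hbc =>
      ⟨fun e => hab.1 (antisymm_of r hab.2 (e ▸ hbc.2)), trans_of r hab.2 hbc.2⟩⟩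
    haveI : Std.Irrefl fun a b : α => a ≠ b ∧ r a b := ⟨fun a ha => ha.1 rfl⟩
    Finite.wellFounded_of_trans_of_irrefl _
  funext i
  induction i using hwf.induction with
  | h i ih =>
    have hi := congrFun h i
    by_cases hmin : ∀ j, r j i → j = i
    · rwa [transferMap_of_minimal hmin, transferMap_of_minimal hmin] at hi
    · obtain ⟨j, hne, hji, e⟩ := (isLeast_transferMap hmin y).1
      obtain ⟨k, hne', hki, e'⟩ := (isLeast_transferMap hmin y').1
      have h₁ := transferMap_le_sub hne hji y'
      have h₂ := transferMap_le_sub hne' hki y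
      have h₃ := ih j ⟨hne, hji⟩
      have h₄ := ih k ⟨hne', hki⟩
      linarith

theorem transferMap_surjOn :
    Set.SurjOn (transferMap α r) (orderPolytope α r) (chainPolytope α r) := by
  intro z hz
  choose y hy using exists_isGreatest_chain_sum r z
  have hy0 : ∀ i, 0 ≤ y i := fun i => (hy i).2 ⟨∅, by simp, by simp, by simp⟩
  have hsingle : ∀ i, z i ≤ y i := fun i =>
    (hy i).2 ⟨{i}, by simpa using refl_of r i, by simpa using refl_of r i, by simp⟩
  refine ⟨y, ⟨fun i => ⟨hy0 i, ?_⟩, fun i j hij => ?_⟩, ?_⟩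
  · obtain ⟨C, hC, -, e⟩ := (hy i).1
    exact e ▸ hz.2 C hC
  · obtain ⟨C, hC, hCi, e⟩ := (hy i).1
    exact (hy j).2 ⟨C, hC, fun a ha => trans_of r (hCi a ha) hij, e⟩
  funext i
  obtain ⟨C, hC, hCi, e⟩ := (hy i).1
  have hle : y i ≤ z i + ∑ a ∈ C.erase i, z a := by
    rw [← e]
    by_cases hi : i ∈ C
    · rw [Finset.add_sum_erase C z hi]
    · rw [Finset.erase_eq_of_notMem hi]
      exact le_add_of_nonneg_left (hz.1 i)
  by_cases hmin : ∀ j, r j i → j = i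
  · rw [transferMap_of_minimal hmin]
    refine le_antisymm ?_ (hsingle i)
    have he : C.erase i = ∅ := Finset.eq_empty_of_forall_notMem fun a ha =>
      Finset.ne_of_mem_erase ha (hmin a (hCi a (Finset.mem_of_mem_erase ha)))
    simpa [he] using hle
  · apply le_antisymm
    · rcases (C.erase i).eq_empty_or_nonempty with he | hne
      · rw [he, Finset.sum_empty, add_zero] at hle
        exact (transferMap_le_self hy0 i).trans hle
      · have hC' : ∀ a ∈ C.erase i, ∀ b ∈ C.erase i, r a b ∨ r b a := fun a ha b hb =>
          hC a (Finset.mem_of_mem_erase ha) b (Finset.mem_of_mem_erase hb)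
        obtain ⟨m, hm, hmax⟩ := exists_greatest_of_chain _ hne hC'
        have h₁ := transferMap_le_sub (Finset.ne_of_mem_erase hm)
          (hCi m (Finset.mem_of_mem_erase hm)) y
        have h₂ : ∑ a ∈ C.erase i, z a ≤ y m := (hy m).2 ⟨_, hC', hmax, rfl⟩
        linarith
    · obtain ⟨j, hne, hji, e'⟩ := (isLeast_transferMap hmin y).1
      obtain ⟨D, hD, hDj, eD⟩ := (hy j).1
      have hi : i ∉ D := fun hi => hne (antisymm_of r hji (hDj i hi))
      have hDi : ∀ a ∈ insert i D, r a i := by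
        intro a ha
        rcases Finset.mem_insert.1 ha with rfl | ha
        exacts [refl_of r a, trans_of r (hDj a ha) hji]
      have h : z i + y j ≤ y i := by
        refine (hy i).2 ⟨insert i D, fun a ha b hb => ?_, hDi, by rw [Finset.sum_insert hi, eD]⟩
        rcases Finset.mem_insert.1 ha with rfl | ha'
        · exact Or.inr (hDi b hb)
        · rcases Finset.mem_insert.1 hb with rfl | hb'
          exacts [Or.inl (hDi a ha), hD a ha' b hb']
      linarith

end TransferMap

/-- Stanley. The transfer map is a bijection from the order polytope
onto the chain polytope. -/
theorem stmt_0 (n : ℕ) (r : Fin n → Fin n → Prop) [IsPartialOrder (Fin n) r] :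
    Set.BijOn (fun y => transferMap (Fin n) r y)
      (orderPolytope (Fin n) r) (chainPolytope (Fin n) r) := by
  exact ⟨transferMap_mapsTo, transferMap_injective.injOn, transferMap_surjOn⟩
end

section
/- Let P be a partially ordered set on the ground set [n] = {1,...,n}. The n-dimensional Lebesgue volume of the order polytope O(P) equals |Δ(P)| / n!, where Δ(P) is the set of linear extensions of P. -/
open MeasureTheory Finset

attribute [local instance] Classical.propDecidable

/-- The points of the unit cube whose coordinates are ordered as prescribed by `σ`. -/
def orderCell {α : Type} [Fintype α] (σ : α ≃ Fin (Fintype.card α)) : Set (α → ℝ) :=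
  {y | (∀ i, 0 ≤ y i ∧ y i ≤ 1) ∧ ∀ i j, y i < y j ↔ σ i < σ j}

theorem measurableSet_orderCell {α : Type} [Fintype α] (σ : α ≃ Fin (Fintype.card α)) :
    MeasurableSet (orderCell σ) := by
  have h : orderCell σ = (⋂ i, {y : α → ℝ | 0 ≤ y i} ∩ {y | y i ≤ 1}) ∩
      ⋂ i, ⋂ j, {y : α → ℝ | y i < y j ↔ σ i < σ j} := by
    ext y; simp [orderCell]
  rw [h]
  refine .inter (.iInter fun i => .inter ?_ ?_) (.iInter fun i => .iInter fun j => ?_)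
  · exact measurableSet_le measurable_const (measurable_pi_apply i)
  · exact measurableSet_le (measurable_pi_apply i) measurable_const
  · by_cases hij : σ i < σ j
    · simpa [hij] using measurableSet_lt (measurable_pi_apply (X := fun _ : α => ℝ) i)
        (measurable_pi_apply j)
    · simpa [hij] using measurableSet_le (measurable_pi_apply (X := fun _ : α => ℝ) j)
        (measurable_pi_apply i)

theorem disjoint_orderCell {α : Type} [Fintype α] {σ τ : α ≃ Fin (Fintype.card α)} (h : σ ≠ τ) :
    Disjoint (orderCell σ) (orderCell τ) := by
  rw [Set.disjoint_left]
  rintro y ⟨-, hσ⟩ ⟨-, hτ⟩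
  apply h
  let e : Fin (Fintype.card α) ≃o Fin (Fintype.card α) :=
    { toEquiv := σ.symm.trans τ
      map_rel_iff' := by
        intro a b
        have h := (hτ (σ.symm b) (σ.symm a)).symm.trans (hσ _ _)
        simp only [Equiv.apply_symm_apply] at h
        simpa using not_congr h }
  ext i
  have he : e (σ i) = σ i := by
    rw [Subsingleton.elim e (OrderIso.refl _)]; rfl
  simpa [e] using congrArg Fin.val he.symm

theorem volume_orderCell_eq {α : Type} [Fintype α] (σ τ : α ≃ Fin (Fintype.card α)) :
    volume (orderCell σ) = volume (orderCell τ) := by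
  have hp := volume_measurePreserving_piCongrLeft (fun _ : α => ℝ) (τ.trans σ.symm).symm
  rw [← hp.measure_preimage_equiv (orderCell τ)]
  congr 1
  ext y
  have hy : ∀ i, MeasurableEquiv.piCongrLeft (fun _ : α => ℝ) (τ.trans σ.symm).symm y i =
      y (σ.symm (τ i)) := by
    intro i
    have := Equiv.piCongrLeft_apply_apply (fun _ : α => ℝ) (τ.trans σ.symm).symm y
      ((τ.trans σ.symm) i)
    rw [MeasurableEquiv.coe_piCongrLeft]
    simpa using this
  simp only [orderCell, Set.mem_preimage, Set.mem_ofPred_eq, hy]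
  constructor
  · rintro ⟨h, h'⟩
    exact ⟨fun i => h _, fun i j => by simpa using h' (σ.symm (τ i)) (σ.symm (τ j))⟩
  · rintro ⟨h, h'⟩
    exact ⟨fun i => by simpa using h (τ.symm (σ i)),
      fun i j => by simpa using h' (τ.symm (σ i)) (τ.symm (σ j))⟩

theorem ae_injective (α : Type) [Fintype α] : ∀ᵐ y : α → ℝ, Function.Injective y := by
  have h : ∀ i j : α, i ≠ j → ∀ᵐ y : α → ℝ, y i ≠ y j := by
    intro i j hij
    have hne : LinearMap.ker
        (LinearMap.proj (R := ℝ) (φ := fun _ : α => ℝ) i - LinearMap.proj j) ≠ ⊤ := by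
      intro htop
      have : Pi.single i (1 : ℝ) ∈ LinearMap.ker
        (LinearMap.proj (R := ℝ) (φ := fun _ : α => ℝ) i - LinearMap.proj j) := by
        rw [htop]; trivial
      simp [hij.symm] at this
    filter_upwards [measure_eq_zero_iff_ae_notMem.1 (Measure.addHaar_submodule volume _ hne)]
      with y hy hyy
    exact hy (by simp [hyy])
  have h' : ∀ᵐ y : α → ℝ, ∀ i j : α, i ≠ j → y i ≠ y j := by
    simp only [ae_all_iff]
    exact h
  filter_upwards [h'] with y hy i j hij
  by_contra hne
  exact hy i j hne hij

theorem exists_equiv_lt_iff_of_injective {α : Type} [Fintype α] {y : α → ℝ}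
    (hy : Function.Injective y) :
    ∃ σ : α ≃ Fin (Fintype.card α), ∀ i j, y i < y j ↔ σ i < σ j := by
  let e := (Finset.univ.image y).orderIsoOfFin (k := Fintype.card α)
    (by rw [Finset.card_image_of_injective _ hy, Finset.card_univ])
  let f : α → Fin (Fintype.card α) := fun i => e.symm ⟨y i, by simp⟩
  have hf : Function.Injective f := fun i j h => hy (by simpa [f] using h)
  refine ⟨Equiv.ofBijective f ((Fintype.bijective_iff_injective_and_card f).2 ⟨hf, by simp⟩), ?_⟩
  intro i j
  simp [f]

theorem volume_orderPolytope_eq_card_mul {α : Type} [Fintype α] (r : α → α → Prop)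
    (τ : α ≃ Fin (Fintype.card α)) :
    volume (orderPolytope α r) = (linExts α r).card * volume (orderCell τ) := by
  have h : orderPolytope α r =ᵐ[volume] ⋃ σ ∈ linExts α r, orderCell σ := by
    refine Filter.eventuallyEq_set.2 ?_
    filter_upwards [ae_injective α] with y hy
    simp only [Set.mem_iUnion, linExts, Finset.mem_filter, Finset.mem_univ, true_and, exists_prop]
    constructor
    · rintro ⟨hc, hr⟩
      obtain ⟨σ, hσ⟩ := exists_equiv_lt_iff_of_injective hy
      exact ⟨σ, fun i j hij => not_lt.1 fun hlt => (hr i j hij).not_gt ((hσ j i).2 hlt), hc, hσ⟩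
    · rintro ⟨σ, hr, hc, hσ⟩
      exact ⟨hc, fun i j hij => not_lt.1 fun hlt => (hr i j hij).not_gt ((hσ j i).1 hlt)⟩
  rw [measure_congr h, measure_biUnion_finset (fun σ _ τ _ hστ => disjoint_orderCell hστ)
    (fun σ _ => measurableSet_orderCell σ),
    Finset.sum_congr rfl (fun σ _ => volume_orderCell_eq σ τ), Finset.sum_const, nsmul_eq_mul]

theorem factorial_mul_volume_orderCell {α : Type} [Fintype α] (τ : α ≃ Fin (Fintype.card α)) :
    ((Fintype.card α).factorial : ENNReal) * volume (orderCell τ) = 1 := by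
  have h := volume_orderPolytope_eq_card_mul (fun _ _ : α => False) τ
  have hcube : orderPolytope α (fun _ _ => False) = Set.Icc 0 1 := by
    ext y; simp [orderPolytope, Pi.le_def, forall_and]
  have hcard : (linExts α (fun _ _ => False)).card = (Fintype.card α).factorial := by
    simp only [linExts, false_imp_iff, implies_true, Finset.filter_true, Finset.card_univ]
    convert Fintype.card_equiv τ
  rw [hcube, hcard, Real.volume_Icc_pi] at h
  simpa using h.symm

/-- The volume of the order polytope equals `|Δ(P)| / n!`. -/
theorem stmt_1 (n : ℕ) (r : Fin n → Fin n → Prop) [IsPartialOrder (Fin n) r] :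
    MeasureTheory.volume (orderPolytope (Fin n) r) =
      ((linExts (Fin n) r).card : ENNReal) / (Nat.factorial n : ENNReal) := by
  have h := factorial_mul_volume_orderCell (Fintype.equivFin (Fin n))
  rw [volume_orderPolytope_eq_card_mul r (Fintype.equivFin (Fin n)), div_eq_mul_inv,
    ENNReal.eq_inv_of_mul_eq_one_left ((mul_comm _ _).trans h)]
  simp only [Fintype.card_fin]
end

section
/- Let P be a partially ordered set on the ground set [n] = {1,...,n}. Then ln(|Δ(P)|) ≤ n(ln n − H(P)), where H(P) is the entropy of P. -/
open MeasureTheory Finset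

attribute [local instance] Classical.propDecidable

/-- Sequences in which every term is a minimal element of the complement of the earlier terms. -/
def IsMinimalRemoval {α : Type} (r : α → α → Prop) {k : ℕ} (f : Fin k → α) : Prop :=
  ∀ j, (∀ i < j, f i ≠ f j) ∧ ∀ x, r x (f j) → x = f j ∨ ∃ i < j, f i = x

/-- The minimal elements of the complement of the range of `f`. -/
noncomputable def minimalRemaining {α : Type} [Fintype α] (r : α → α → Prop) {k : ℕ}
    (f : Fin k → α) : Finset α :=
  Finset.univ.filter fun x => (∀ i, f i ≠ x) ∧ ∀ y, r y x → y = x ∨ ∃ i, f i = y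

lemma isMinimalRemoval_snoc {α : Type} [Fintype α] (r : α → α → Prop) {k : ℕ}
    (f : Fin k → α) (x : α) :
    IsMinimalRemoval r (Fin.snoc f x : Fin (k + 1) → α) ↔
      IsMinimalRemoval r f ∧ x ∈ minimalRemaining r f := by
  simp [IsMinimalRemoval, minimalRemaining, Fin.forall_fin_succ', Fin.exists_fin_succ',
    Fin.castSucc_lt_last, Fin.castSucc_lt_castSucc_iff, (Fin.castSucc_lt_last _).not_gt]

lemma sum_prod_isMinimalRemoval_le_one {α : Type} [Fintype α] (r : α → α → Prop) (a : α → ℝ)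
    (ha : ∀ i, 0 ≤ a i)
    (hA : ∀ A : Finset α, (∀ i ∈ A, ∀ j ∈ A, r i j → i = j) → ∑ i ∈ A, a i ≤ 1) (k : ℕ) :
    ∑ f : Fin k → α with IsMinimalRemoval r f, ∏ j, a (f j) ≤ 1 := by
  induction k with
  | zero => simp [IsMinimalRemoval]
  | succ k ih =>
    refine le_trans ?_ ih
    rw [Finset.sum_filter, Finset.sum_filter,
      ← (Fin.snocEquiv (fun _ : Fin (k + 1) => α)).sum_comp, Fintype.sum_prod_type_right]
    refine Finset.sum_le_sum fun f _ => ?_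
    have key : ∀ x : α,
        (if IsMinimalRemoval r (Fin.snoc f x : Fin (k + 1) → α)
          then ∏ j, a ((Fin.snoc f x : Fin (k + 1) → α) j) else 0) =
        if IsMinimalRemoval r f then
          (∏ j, a (f j)) * (if x ∈ minimalRemaining r f then a x else 0) else 0 := by
      intro x
      rw [Fin.prod_univ_castSucc]
      simp only [isMinimalRemoval_snoc, Fin.snoc_castSucc, Fin.snoc_last]
      split_ifs <;> simp_all
    refine (Finset.sum_congr rfl fun x _ => key x).trans_le ?_
    split_ifs with hf
    · rw [← Finset.mul_sum, ← Finset.sum_filter, Finset.filter_mem_eq_inter, Finset.univ_inter]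
      refine mul_le_of_le_one_right (Finset.prod_nonneg fun j _ => ha _) (hA _ ?_)
      intro x hx y hy hxy
      simp only [minimalRemaining, Finset.mem_filter, Finset.mem_univ, true_and] at hx hy
      rcases hy.2 x hxy with h | ⟨i, hi⟩
      · exact h
      · exact absurd hi (hx.1 i)
    · simp

/-- If all antichains have weight at most one, then the number of linear extensions times the
product of the weights is at most one. -/
lemma card_linExts_mul_prod_le_one {α : Type} [Fintype α] (r : α → α → Prop) (a : α → ℝ)
    (ha : ∀ i, 0 ≤ a i)
    (hA : ∀ A : Finset α, (∀ i ∈ A, ∀ j ∈ A, r i j → i = j) → ∑ i ∈ A, a i ≤ 1) :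
    ((linExts α r).card : ℝ) * ∏ i, a i ≤ 1 := by
  refine le_trans ?_ (sum_prod_isMinimalRemoval_le_one r a ha hA (Fintype.card α))
  let e : (α ≃ Fin (Fintype.card α)) → (Fin (Fintype.card α) → α) := fun σ => σ.symm
  have he : Function.Injective e := fun σ τ h => by
    have : σ.symm = τ.symm := DFunLike.coe_injective h
    simpa using congrArg Equiv.symm this
  have hsub : (linExts α r).image e ⊆
      Finset.univ.filter fun f : Fin (Fintype.card α) → α => IsMinimalRemoval r f := by
    intro f hf
    obtain ⟨σ, hσ, rfl⟩ := Finset.mem_image.1 hf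
    simp only [linExts, Finset.mem_filter, Finset.mem_univ, true_and] at hσ ⊢
    refine fun j => ⟨fun i hij h => hij.ne (σ.symm.injective h), fun x hx => ?_⟩
    have hle : σ x ≤ j := by simpa [e] using hσ _ _ hx
    rcases hle.eq_or_lt with h | h
    · exact Or.inl ((Equiv.eq_symm_apply σ).2 h)
    · exact Or.inr ⟨σ x, h, σ.symm_apply_apply x⟩
  refine le_trans (le_of_eq ?_) (Finset.sum_le_sum_of_subset_of_nonneg hsub
    fun f _ _ => Finset.prod_nonneg fun j _ => ha _)
  rw [Finset.sum_image he.injOn,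
    Finset.sum_congr rfl fun σ _ => σ.symm.prod_comp a, Finset.sum_const, nsmul_eq_mul]

lemma isCompact_chainPolytope (α : Type) [Fintype α] (r : α → α → Prop) (hr : ∀ i, r i i) :
    IsCompact (chainPolytope α r) := by
  refine (isCompact_Icc (a := (0 : α → ℝ)) (b := 1)).of_isClosed_subset ?_ ?_
  · simp only [chainPolytope, Set.ofPred_and, Set.ofPred_forall]
    refine IsClosed.inter (isClosed_iInter fun i => ?_)
      (isClosed_iInter fun C => isClosed_iInter fun _ => ?_)
    · exact isClosed_le (by fun_prop) (by fun_prop)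
    · exact isClosed_le (by fun_prop) (by fun_prop)
  · rintro y ⟨h0, h1⟩
    exact ⟨fun i => h0 i, fun i => by simpa using h1 {i} (by simpa using hr i)⟩

lemma convex_chainPolytope (α : Type) [Fintype α] (r : α → α → Prop) :
    Convex ℝ (chainPolytope α r) := by
  rintro x ⟨hx0, hx⟩ y ⟨hy0, hy⟩ s t hs ht hst
  refine ⟨fun i => ?_, fun C hC => ?_⟩
  · exact add_nonneg (mul_nonneg hs (hx0 i)) (mul_nonneg ht (hy0 i))
  · simp only [Pi.add_apply, Pi.smul_apply, smul_eq_mul, Finset.sum_add_distrib, ← Finset.mul_sum]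
    nlinarith [hx C hC, hy C hC]

lemma const_inv_card_mem_chainPolytope (α : Type) [Fintype α] [Nonempty α] (r : α → α → Prop) :
    (fun _ => (Fintype.card α : ℝ)⁻¹) ∈ chainPolytope α r := by
  refine ⟨fun _ => by positivity, fun C _ => ?_⟩
  have hC : (C.card : ℝ) ≤ Fintype.card α := by exact_mod_cast C.card_le_univ
  rw [Finset.sum_const, nsmul_eq_mul, ← div_eq_mul_inv]
  exact div_le_one_of_le₀ hC (by positivity)

lemma antichain_indicator_mem_chainPolytope (α : Type) [Fintype α] (r : α → α → Prop)
    (A : Finset α) (hA : ∀ i ∈ A, ∀ j ∈ A, r i j → i = j) :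
    (fun i => if i ∈ A then (1 : ℝ) else 0) ∈ chainPolytope α r := by
  refine ⟨fun i => by positivity, fun C hC => ?_⟩
  rw [Finset.sum_boole]
  have : (C.filter (· ∈ A)).card ≤ 1 := by
    refine Finset.card_le_one.2 fun i hi j hj => ?_
    rw [Finset.mem_filter] at hi hj
    rcases hC i hi.1 j hj.1 with h | h
    · exact hA i hi.2 j hj.2 h
    · exact (hA j hj.2 i hi.2 h).symm
  exact_mod_cast this

/-- First-order optimality for maximizing a product of coordinates over a convex set. -/
lemma sum_div_le_card_of_prod_le {α : Type} [Fintype α] {K : Set (α → ℝ)} (hK : Convex ℝ K)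
    {z : α → ℝ} (hz : z ∈ K) (hpos : ∀ i, 0 < z i) (hmax : ∀ y ∈ K, ∏ i, y i ≤ ∏ i, z i)
    {y : α → ℝ} (hy : y ∈ K) : ∑ i, y i / z i ≤ Fintype.card α := by
  let g : ℝ → ℝ := fun t => ∏ i, (1 + t * (y i / z i - 1))
  have hg : HasDerivAt g (∑ i, (y i / z i - 1)) 0 := by
    have h := HasDerivAt.fun_finsetProd (u := (Finset.univ : Finset α)) (x := (0 : ℝ))
      (f := fun i t => 1 + t * (y i / z i - 1)) (f' := fun i => y i / z i - 1)
      fun i _ => by simpa using ((hasDerivAt_id (0 : ℝ)).mul_const (y i / z i - 1)).const_add 1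
    simpa [g] using h
  have hle : ∀ t ∈ Set.Icc (0 : ℝ) 1, g t ≤ g 0 := by
    intro t ht
    have h := hmax _ (hK hz hy (sub_nonneg.2 ht.2) ht.1 (by ring))
    have heq : ∏ i, ((1 - t) • z + t • y) i = g t * ∏ i, z i := by
      rw [← Finset.prod_mul_distrib]
      refine Finset.prod_congr rfl fun i _ => ?_
      have := (hpos i).ne'
      simp only [Pi.add_apply, Pi.smul_apply, smul_eq_mul]
      field_simp
      ring
    rw [heq] at h
    have hp : 0 < ∏ i, z i := Finset.prod_pos fun i _ => hpos i
    have : g 0 = 1 := by simp [g]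
    rw [this]
    exact (mul_le_iff_le_one_left hp).1 h
  have hd : ∑ i, (y i / z i - 1) ≤ 0 := by
    refine le_of_tendsto (hg.tendsto_slope.mono_left
      (nhdsWithin_mono (0 : ℝ) (fun t (ht : t ∈ Set.Ioi (0 : ℝ)) => ne_of_gt ht))) ?_
    filter_upwards [Ioo_mem_nhdsGT (zero_lt_one : (0 : ℝ) < 1)] with t ht
    rw [slope_def_field]
    exact div_nonpos_of_nonpos_of_nonneg (sub_nonpos.2 (hle t ⟨ht.1.le, ht.2.le⟩))
      (by simpa using ht.1.le)
  simpa [Finset.sum_sub_distrib] using hd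

/-- Kahn–Kim. `ln |Δ(P)| ≤ n (ln n − H(P))`. -/
theorem stmt_2 (n : ℕ) (r : Fin n → Fin n → Prop) [IsPartialOrder (Fin n) r] :
    Real.log ((linExts (Fin n) r).card) ≤
      (n : ℝ) * (Real.log n - posetEntropy (Fin n) r) := by
  rcases Nat.eq_zero_or_pos n with rfl | hn
  · have h := card_linExts_mul_prod_le_one r (fun _ => 0) (by simp) (by simp)
    simp only [Finset.univ_eq_empty, Finset.prod_empty, mul_one] at h
    simpa using Real.log_nonpos (by positivity) h
  have : NeZero n := ⟨hn.ne'⟩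
  have hn0 : (0 : ℝ) < n := by exact_mod_cast hn
  obtain ⟨z, hz, hmax⟩ := (isCompact_chainPolytope (Fin n) r (refl_of r)).exists_isMaxOn
    ⟨_, const_inv_card_mem_chainPolytope (Fin n) r⟩
    (f := fun y => ∏ i, y i) (by fun_prop)
  replace hmax : ∀ y ∈ chainPolytope (Fin n) r, ∏ i, y i ≤ ∏ i, z i := hmax
  have hconst : ((n : ℝ)⁻¹) ^ n ≤ ∏ i, z i := by
    simpa using hmax _ (const_inv_card_mem_chainPolytope (Fin n) r)
  have hprod : 0 < ∏ i, z i := lt_of_lt_of_le (by positivity) hconst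
  have hpos : ∀ i, 0 < z i := fun i =>
    (hz.1 i).lt_of_ne' (Finset.prod_ne_zero_iff.1 hprod.ne' i (Finset.mem_univ i))
  have hH : posetEntropy (Fin n) r ≤ -(1 / (n : ℝ)) * Real.log (∏ i, z i) := by
    refine csInf_le ⟨-(1 / (n : ℝ)) * Real.log (∏ i, z i), ?_⟩ ⟨z, hz, hpos, ?_⟩
    · rintro x ⟨y, hy, hypos, rfl⟩
      rw [Fintype.card_fin, ← Real.log_prod fun i _ => (hypos i).ne']
      exact mul_le_mul_of_nonpos_left
        (Real.log_le_log (Finset.prod_pos fun i _ => hypos i) (hmax y hy))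
        (neg_nonpos.2 (by positivity))
    · rw [Fintype.card_fin, ← Real.log_prod fun i _ => (hpos i).ne']
  have hcount := card_linExts_mul_prod_le_one r (fun i => ((n : ℝ) * z i)⁻¹)
    (fun i => inv_nonneg.2 (mul_nonneg hn0.le (hpos i).le)) fun A hA => by
      have h := sum_div_le_card_of_prod_le (convex_chainPolytope (Fin n) r) hz hpos hmax
        (antichain_indicator_mem_chainPolytope (Fin n) r A hA)
      simp only [Fintype.card_fin, ite_div, zero_div, Finset.sum_ite_mem, Finset.univ_inter] at h
      simp only [mul_inv, ← Finset.mul_sum, ← one_div (z _)]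
      rwa [inv_mul_le_iff₀ hn0, mul_one]
  have hbound : ((linExts (Fin n) r).card : ℝ) ≤ (n : ℝ) ^ n * ∏ i, z i := by
    rw [Finset.prod_inv_distrib, Finset.prod_mul_distrib, Fin.prod_const, ← div_eq_mul_inv,
      div_le_one (by positivity)] at hcount
    exact hcount
  have hlog : Real.log ((linExts (Fin n) r).card) ≤ n * Real.log n + Real.log (∏ i, z i) := by
    rw [← Real.log_pow, ← Real.log_mul (by positivity) hprod.ne']
    rcases Nat.eq_zero_or_pos (linExts (Fin n) r).card with h | h
    · rw [h, Nat.cast_zero, Real.log_zero]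
      refine Real.log_nonneg ?_
      rwa [inv_pow, inv_le_iff_one_le_mul₀' (by positivity)] at hconst
    · exact Real.log_le_log (by exact_mod_cast h) hbound
  have hmul := mul_le_mul_of_nonneg_left hH hn0.le
  have hcancel : (n : ℝ) * (-(1 / (n : ℝ)) * Real.log (∏ i, z i)) = -Real.log (∏ i, z i) := by
    field_simp
  linarith
end

section
/- Let P be a partially ordered set on the ground set [n] = {1,...,n}. Then n(ln n − H(P)) ≤ 2 · ln(|Δ(P)|), where H(P) is the entropy of P. -/
open MeasureTheory Finset

attribute [local instance] Classical.propDecidable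

section EntropyInequality

/-- The ratio `(-p log p + (1 - p) log (1 - p)) / p`. -/
noncomputable def entropySkew (p : ℝ) : ℝ := -Real.log p + (p⁻¹ - 1) * Real.log (1 - p)

lemma hasDerivAt_entropySkew {p : ℝ} (h0 : 0 < p) (h1 : p < 1) :
    HasDerivAt entropySkew (-p⁻¹ + (-(p ^ 2)⁻¹ * Real.log (1 - p)
      + (p⁻¹ - 1) * (-1 / (1 - p)))) p := by
  have hlog : HasDerivAt (fun x : ℝ => Real.log (1 - x)) (-1 / (1 - p)) p :=
    ((hasDerivAt_id p).const_sub 1).log (by simp; linarith)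
  exact (Real.hasDerivAt_log h0.ne').neg.add (((hasDerivAt_inv h0.ne').sub_const 1).mul hlog)

lemma antitoneOn_entropySkew : AntitoneOn entropySkew (Set.Ioc 0 (1 / 2)) := by
  have hd : ∀ p ∈ Set.Ioc (0 : ℝ) (1 / 2), 0 < p ∧ p < 1 := fun p hp =>
    ⟨hp.1, by linarith [hp.2]⟩
  refine antitoneOn_of_deriv_nonpos (convex_Ioc _ _)
    (fun p hp => (hasDerivAt_entropySkew (hd p hp).1 (hd p hp).2).continuousAt.continuousWithinAt)
    (fun p hp => ?_) (fun p hp => ?_)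
  · have hp' := hd p (interior_subset hp)
    exact (hasDerivAt_entropySkew hp'.1 hp'.2).differentiableAt.differentiableWithinAt
  · have hm := interior_subset hp
    obtain ⟨h0, h1⟩ := hd p hm
    rw [(hasDerivAt_entropySkew h0 h1).deriv]
    have hq : 0 < 1 - p := by linarith
    have hlog := Real.one_sub_inv_le_log_of_pos hq
    have hinv : (1 - p)⁻¹ ≤ 1 + 2 * p := by
      rw [inv_le_iff_one_le_mul₀ hq]
      nlinarith [hm.2]
    have heq : -p⁻¹ + (-(p ^ 2)⁻¹ * Real.log (1 - p) + (p⁻¹ - 1) * (-1 / (1 - p)))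
        = (p ^ 2)⁻¹ * (-Real.log (1 - p) - 2 * p) := by
      field_simp
      ring
    rw [heq]
    exact mul_nonpos_of_nonneg_of_nonpos (by positivity) (by linarith)

lemma mul_entropySkew (p : ℝ) :
    p * entropySkew p = -(p * Real.log p) + (1 - p) * Real.log (1 - p) := by
  rcases eq_or_ne p 0 with rfl | h
  · simp
  · unfold entropySkew
    field_simp

lemma entropySkew_half : entropySkew (1 / 2) = 0 := by
  unfold entropySkew
  norm_num

/-- The entropy of a probability vector dominates `∑ -(1 - pᵢ) log (1 - pᵢ)`. -/
lemma sum_mul_entropySkew_nonneg {ι : Type*} (M : Finset ι) (p : ι → ℝ)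
    (hp : ∀ i ∈ M, 0 < p i) (hsum : ∑ i ∈ M, p i = 1) :
    0 ≤ ∑ i ∈ M, p i * entropySkew (p i) := by
  by_cases hall : ∀ i ∈ M, p i ≤ 1 / 2
  · refine Finset.sum_nonneg fun i hi => mul_nonneg (hp i hi).le ?_
    have := antitoneOn_entropySkew ⟨hp i hi, hall i hi⟩ (by norm_num) (hall i hi)
    rwa [entropySkew_half] at this
  · push Not at hall
    obtain ⟨a, ha, hpa⟩ := hall
    rw [← Finset.add_sum_erase _ _ ha] at hsum ⊢
    have hq : ∑ i ∈ M.erase a, p i = 1 - p a := by linarith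
    have hle : ∀ i ∈ M.erase a, p i * entropySkew (1 - p a) ≤ p i * entropySkew (p i) := by
      intro i hi
      have hpi := hp i (Finset.mem_of_mem_erase hi)
      have hi1 : p i ≤ 1 - p a := hq ▸ Finset.single_le_sum
        (fun j hj => (hp j (Finset.mem_of_mem_erase hj)).le) hi
      exact mul_le_mul_of_nonneg_left (antitoneOn_entropySkew ⟨hpi, by linarith⟩
        ⟨by linarith, by linarith⟩ hi1) hpi.le
    have hS := Finset.sum_le_sum hle
    rw [← Finset.sum_mul, hq, mul_entropySkew] at hS
    rw [mul_entropySkew]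
    simp only [sub_sub_cancel] at hS
    linarith

end EntropyInequality

section Extensions

variable {α : Type} (r : α → α → Prop)

/-- Linear extensions of `r` restricted to `S`, written as lists. -/
noncomputable def listExts (S : Finset α) : Finset (List α) :=
  (⟨Multiset.lists S.val, Multiset.lists_nodup_finset S⟩ : Finset (List α)).filter fun l => l.Pairwise fun x y => ¬ r y x

/-- The minimal elements of `S`. -/
noncomputable def minimalElems (S : Finset α) : Finset α :=
  S.filter fun i => ∀ j ∈ S, r j i → j = i

/-- Finite chains of `r` inside `S`. -/
def IsChainIn (S C : Finset α) : Prop :=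
  C ⊆ S ∧ ∀ i ∈ C, ∀ j ∈ C, r i j ∨ r j i

lemma mem_listExts {S : Finset α} {l : List α} :
    l ∈ listExts r S ↔ S.val = ↑l ∧ l.Pairwise fun x y => ¬ r y x := by
  simp [listExts, Multiset.mem_lists_iff]

lemma sum_card_listExts_erase_le (S : Finset α) :
    ∑ b ∈ minimalElems r S, (listExts r (S.erase b)).card ≤ (listExts r S).card := by
  rw [← Finset.card_sigma]
  refine Finset.card_le_card_of_injOn (fun x => x.1 :: x.2) ?_ ?_
  · rintro ⟨b, l⟩ hx
    simp only [Finset.coe_sigma, Set.mem_sigma_iff, Finset.mem_coe, mem_listExts] at hx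
    obtain ⟨hb, hl, hpair⟩ := hx
    obtain ⟨hbS, hmin⟩ := Finset.mem_filter.1 hb
    rw [Finset.mem_coe, mem_listExts]
    refine ⟨?_, List.pairwise_cons.2 ⟨fun y hy hyb => ?_, hpair⟩⟩
    · rw [← Multiset.cons_coe, ← hl, Finset.erase_val, Multiset.cons_erase hbS]
    · have hy' : y ∈ S.erase b := by
        rw [← Finset.mem_val, hl]
        exact hy
      exact (Finset.mem_erase.1 hy').1 (hmin y (Finset.mem_erase.1 hy').2 hyb)
  · rintro ⟨b, l⟩ - ⟨c, m⟩ - h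
    simp only [List.cons.injEq] at h
    obtain ⟨rfl, rfl⟩ := h
    rfl

lemma card_listExts_le_card_linExts [Fintype α] :
    (listExts r (Finset.univ : Finset α)).card ≤ (linExts α r).card := by
  have hsub : listExts r (Finset.univ : Finset α) ⊆
      (linExts α r).image fun σ => List.ofFn σ.symm := by
    intro l hl
    obtain ⟨hl, hpair⟩ := (mem_listExts r).1 hl
    have hnd : l.Nodup := by
      rw [← Multiset.coe_nodup, ← hl]
      exact Finset.univ.nodup
    have hmem : ∀ x, x ∈ l := fun x => by
      rw [← Multiset.mem_coe, ← hl]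
      exact Finset.mem_univ x
    have hlen : l.length = Fintype.card α := by
      rw [← Multiset.coe_card, ← hl]
      rfl
    let σ : α ≃ Fin (Fintype.card α) :=
      (List.Nodup.getEquivOfForallMemList l hnd hmem).symm.trans (finCongr hlen)
    have hσ : ∀ k : Fin (Fintype.card α), σ.symm k = l[k.val]'(by rw [hlen]; exact k.isLt) := fun _ => rfl
    refine Finset.mem_image.2 ⟨σ, Finset.mem_filter.2 ⟨Finset.mem_univ _, ?_⟩, ?_⟩
    · intro i j hij
      by_contra hlt
      rw [not_le] at hlt
      have := List.pairwise_iff_getElem.1 hpair (σ j) (σ i) (by rw [hlen]; exact (σ j).isLt)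
        (by rw [hlen]; exact (σ i).isLt) hlt
      rw [← hσ, ← hσ, Equiv.symm_apply_apply, Equiv.symm_apply_apply] at this
      exact this hij
    · refine List.ext_getElem (by simp [hlen]) fun k h1 h2 => ?_
      simp [hσ]
  exact (Finset.card_le_card hsub).trans Finset.card_image_le

/-- Nonnegative weights on `S` whose sum along every chain is at most `T`. -/
def chainBody (S : Finset α) (T : ℝ) : Set (α → ℝ) :=
  {z | (∀ i ∈ S, 0 ≤ z i) ∧ ∀ C, IsChainIn r S C → ∑ i ∈ C, z i ≤ T}

lemma isClosed_chainBody (S : Finset α) (T : ℝ) : IsClosed (chainBody r S T) := by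
  have h : chainBody r S T = (⋂ i ∈ S, {z : α → ℝ | 0 ≤ z i}) ∩
      ⋂ (C : Finset α) (_ : IsChainIn r S C), {z : α → ℝ | ∑ i ∈ C, z i ≤ T} := by
    ext z
    simp [chainBody]
  rw [h]
  exact (isClosed_iInter fun i => isClosed_iInter fun _ =>
      isClosed_le continuous_const (by fun_prop)).inter
    (isClosed_iInter fun C => isClosed_iInter fun _ =>
      isClosed_le (by fun_prop) continuous_const)

variable [IsPartialOrder α r]

lemma exists_isChainIn_superset {S C : Finset α} (hS : S.Nonempty) (hC : IsChainIn r S C) :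
    ∃ D, C ⊆ D ∧ IsChainIn r S D ∧ ∃ m ∈ D, m ∈ minimalElems r S := by
  obtain ⟨D, hCD, hD⟩ := (S.powerset.filter (IsChainIn r S)).exists_le_maximal
    (Finset.mem_filter.2 ⟨Finset.mem_powerset.2 hC.1, hC⟩)
  have hDc : IsChainIn r S D := (Finset.mem_filter.1 hD.prop).2
  have hins : ∀ j ∈ S, (∀ x ∈ D, r j x) → j ∈ D := by
    intro j hj hjD
    have hc : IsChainIn r S (insert j D) := by
      refine ⟨Finset.insert_subset hj hDc.1, ?_⟩
      intro x hx y hy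
      rcases Finset.mem_insert.1 hx with rfl | hxD <;>
        rcases Finset.mem_insert.1 hy with rfl | hyD
      · exact Or.inl (refl_of r _)
      · exact Or.inl (hjD y hyD)
      · exact Or.inr (hjD x hxD)
      · exact hDc.2 x hxD y hyD
    exact hD.le_of_ge (Finset.mem_filter.2 ⟨Finset.mem_powerset.2 hc.1, hc⟩)
      (Finset.subset_insert _ _) (Finset.mem_insert_self _ _)
  have hne : D.Nonempty := by
    by_contra h
    rw [Finset.not_nonempty_iff_eq_empty] at h
    obtain ⟨s, hs⟩ := hS
    simpa [h] using hins s hs (by simp [h])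
  have hleast : ∀ T : Finset α, T.Nonempty → T ⊆ D → ∃ m ∈ T, ∀ x ∈ T, r m x := by
    intro T hT
    induction hT using Finset.Nonempty.cons_induction with
    | singleton a => exact fun _ => ⟨a, by simp, by simpa using refl_of r a⟩
    | cons a T ha hT ih =>
      intro hTD
      have haD : a ∈ D := hTD (Finset.mem_cons_self _ _)
      have hTD' : T ⊆ D := fun x hx => hTD (Finset.mem_cons_of_mem hx)
      obtain ⟨m, hm, hmT⟩ := ih hTD'
      rcases hDc.2 a haD m (hTD' hm) with h | h
      · refine ⟨a, Finset.mem_cons_self _ _, fun x hx => ?_⟩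
        rcases Finset.mem_cons.1 hx with rfl | hx
        · exact refl_of r _
        · exact trans_of r h (hmT x hx)
      · refine ⟨m, Finset.mem_cons_of_mem hm, fun x hx => ?_⟩
        rcases Finset.mem_cons.1 hx with rfl | hx
        · exact h
        · exact hmT x hx
  obtain ⟨m, hm, hmD⟩ := hleast D hne subset_rfl
  refine ⟨D, hCD, hDc, m, hm, Finset.mem_filter.2 ⟨hDc.1 hm, fun j hj hjm => ?_⟩⟩
  exact antisymm_of r hjm (hmD j (hins j hj fun x hx => trans_of r hjm (hmD x hx)))

/-- Shortening all minimal elements by `ε` shortens every chain bound by `ε`. -/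
lemma sum_sub_minimalElems_le {S : Finset α} (hS : S.Nonempty) {z : α → ℝ} {T ε : ℝ}
    (hz : ∀ i ∈ S, 0 ≤ z i) (hzT : ∀ C, IsChainIn r S C → ∑ i ∈ C, z i ≤ T)
    (hε : ∀ i ∈ minimalElems r S, ε ≤ z i) {C : Finset α} (hC : IsChainIn r S C) :
    ∑ i ∈ C, (z i - if i ∈ minimalElems r S then ε else 0) ≤ T - ε := by
  obtain ⟨D, hCD, hD, m, hmD, hm⟩ := exists_isChainIn_superset r hS hC
  have huniq : ∀ i ∈ D, i ∈ minimalElems r S ↔ i = m := by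
    intro i hi
    refine ⟨fun hiM => ?_, fun h => h ▸ hm⟩
    rcases hD.2 i hi m hmD with h | h
    · exact (Finset.mem_filter.1 hm).2 i (hD.1 hi) h
    · exact ((Finset.mem_filter.1 hiM).2 m (hD.1 hmD) h).symm
  calc ∑ i ∈ C, (z i - if i ∈ minimalElems r S then ε else 0)
      ≤ ∑ i ∈ D, (z i - if i ∈ minimalElems r S then ε else 0) := by
        refine Finset.sum_le_sum_of_subset_of_nonneg hCD fun i hi _ => ?_
        split_ifs with h
        · linarith [hε i h]
        · linarith [hz i (hD.1 hi)]
    _ = ∑ i ∈ D, z i - ∑ i ∈ D, (if i = m then ε else 0) := by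
        rw [Finset.sum_sub_distrib]
        congr 1
        exact Finset.sum_congr rfl fun i hi => by simp only [huniq i hi]
    _ ≤ T - ε := by
        rw [Finset.sum_ite_eq' D m, if_pos hmD]
        linarith [hzT D hD]

lemma exists_maximizer (S : Finset α) :
    ∃ z ∈ chainBody r S S.card, (∀ i ∈ S, 0 < z i) ∧
      ∀ y ∈ chainBody r S S.card, ∏ i ∈ S, y i ≤ ∏ i ∈ S, z i := by
  have hK : IsCompact (chainBody r S S.card ∩ Set.Icc 0 fun _ => (S.card : ℝ)) :=
    isCompact_Icc.inter_left (isClosed_chainBody r S _)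
  have htrunc : ∀ y ∈ chainBody r S S.card, (fun i => if i ∈ S then y i else 0) ∈
      chainBody r S S.card ∩ Set.Icc 0 fun _ => (S.card : ℝ) := by
    rintro y ⟨h0, hC⟩
    refine ⟨⟨fun i hi => ?_, fun C hCc => ?_⟩, fun i => ?_, fun i => ?_⟩
    · simpa [hi] using h0 i hi
    · rw [Finset.sum_congr rfl fun i hi => if_pos (hCc.1 hi)]
      exact hC C hCc
    · by_cases hi : i ∈ S
      · simpa [hi] using h0 i hi
      · simp [hi]
    · by_cases hi : i ∈ S
      · simpa [hi] using hC {i} ⟨by simpa using hi, by simpa using refl_of r i⟩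
      · simp [hi]
  have hone : (fun _ => (1 : ℝ)) ∈ chainBody r S S.card := by
    refine ⟨fun _ _ => zero_le_one, fun C hC => ?_⟩
    simpa using Finset.card_le_card hC.1
  obtain ⟨z, hz, hmax⟩ := hK.exists_isMaxOn ⟨_, htrunc _ hone⟩
    (f := fun z => ∏ i ∈ S, z i) (by fun_prop)
  have hmax' : ∀ y ∈ chainBody r S S.card, ∏ i ∈ S, y i ≤ ∏ i ∈ S, z i := by
    intro y hy
    have h : ∏ i ∈ S, (if i ∈ S then y i else 0) ≤ ∏ i ∈ S, z i := hmax (htrunc y hy)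
    rwa [Finset.prod_congr rfl fun i hi => if_pos hi] at h
  refine ⟨z, hz.1, fun i hi => (hz.1.1 i hi).lt_of_ne' ?_, hmax'⟩
  have h1 : 0 < ∏ i ∈ S, z i := by
    have := hmax' _ hone
    rw [Finset.prod_const_one] at this
    linarith
  exact Finset.prod_ne_zero_iff.1 h1.ne' i hi

/-- First-order optimality for the maximizer of the product. -/
lemma sum_inv_minimalElems_eq_one {S : Finset α} (hS : S.Nonempty) {z : α → ℝ}
    (hz : z ∈ chainBody r S S.card) (hpos : ∀ i ∈ S, 0 < z i)
    (hmax : ∀ y ∈ chainBody r S S.card, ∏ i ∈ S, y i ≤ ∏ i ∈ S, z i) :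
    ∑ i ∈ minimalElems r S, (z i)⁻¹ = 1 := by
  have hn : (0 : ℝ) < S.card := by exact_mod_cast hS.card_pos
  have hMS : minimalElems r S ⊆ S := Finset.filter_subset _ _
  set n : ℝ := (S.card : ℝ)
  let G : ℝ → ℝ := fun ε =>
    ∑ i ∈ S, Real.log (z i - if i ∈ minimalElems r S then ε else 0) - n * Real.log (n - ε)
  have hloc : IsLocalMax G 0 := by
    have h1 : ∀ᶠ ε in nhds (0 : ℝ), ∀ i ∈ S, ε < z i :=
      (Filter.eventually_all_finset S).2 fun i hi => eventually_lt_nhds (hpos i hi)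
    filter_upwards [h1, eventually_lt_nhds hn] with ε hε hεn
    have hw : ∀ i ∈ S, 0 < z i - if i ∈ minimalElems r S then ε else 0 := by
      intro i hi
      split_ifs
      · linarith [hε i hi]
      · linarith [hpos i hi]
    have hd : 0 < n - ε := by linarith
    have hc : 0 < n / (n - ε) := div_pos hn hd
    have hmem : (fun i => n / (n - ε) * (z i - if i ∈ minimalElems r S then ε else 0)) ∈
        chainBody r S n := by
      refine ⟨fun i hi => (mul_pos hc (hw i hi)).le, fun C hC => ?_⟩
      rw [← Finset.mul_sum]
      calc _ ≤ n / (n - ε) * (n - ε) := mul_le_mul_of_nonneg_left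
            (sum_sub_minimalElems_le r hS hz.1 hz.2 (fun i hi => (hε i (hMS hi)).le) hC) hc.le
        _ = n := div_mul_cancel₀ _ hd.ne'
    have hprod := Real.log_le_log (Finset.prod_pos fun i hi => mul_pos hc (hw i hi))
      (hmax _ hmem)
    rw [Real.log_prod fun i hi => (mul_pos hc (hw i hi)).ne',
      Real.log_prod fun i hi => (hpos i hi).ne',
      Finset.sum_congr rfl fun i hi => Real.log_mul hc.ne' (hw i hi).ne',
      Finset.sum_add_distrib, Finset.sum_const, nsmul_eq_mul, Real.log_div hn.ne' hd.ne'] at hprod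
    simp only [G, ite_self, sub_zero]
    change n * _ + _ ≤ _ at hprod
    linarith
  have hderiv : HasDerivAt G (∑ i ∈ S, (-(if i ∈ minimalElems r S then 1 else 0)) /
      (z i - if i ∈ minimalElems r S then (0 : ℝ) else 0) - n * (-1 / (n - 0))) 0 := by
    refine HasDerivAt.sub (HasDerivAt.fun_sum fun i hi => ?_) (HasDerivAt.const_mul n ?_)
    · refine HasDerivAt.log ?_ (by simpa using (hpos i hi).ne')
      split_ifs
      · exact (hasDerivAt_id (0 : ℝ)).const_sub (z i)
      · simpa using hasDerivAt_const (0 : ℝ) (z i)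
    · exact ((hasDerivAt_id (0 : ℝ)).const_sub n).log (by simpa using hn.ne')
  have h0 := hloc.hasDerivAt_eq_zero hderiv
  have hterm : ∀ i ∈ S, (-(if i ∈ minimalElems r S then 1 else 0)) /
      (z i - if i ∈ minimalElems r S then (0 : ℝ) else 0) =
      -(if i ∈ minimalElems r S then (z i)⁻¹ else 0) := by
    intro i _
    split_ifs <;> simp [neg_div]
  rw [Finset.sum_congr rfl hterm, Finset.sum_neg_distrib, Finset.sum_ite_mem,
    Finset.inter_eq_right.2 hMS, sub_zero, neg_div, div_eq_mul_inv, one_mul, mul_neg,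
    mul_inv_cancel₀ hn.ne'] at h0
  linarith

theorem prod_le_sq_card_listExts (S : Finset α) :
    ∀ y ∈ chainBody r S S.card, ∏ i ∈ S, y i ≤ ((listExts r S).card : ℝ) ^ 2 := by
  induction S using Finset.strongInduction with
  | H S ih =>
  intro y hy
  rcases S.eq_empty_or_nonempty with rfl | hS
  · have h : 0 < (listExts r (∅ : Finset α)).card :=
      Finset.card_pos.2 ⟨[], (mem_listExts r).2 ⟨rfl, List.Pairwise.nil⟩⟩
    rw [Finset.prod_empty]
    exact one_le_pow₀ (by exact_mod_cast h)
  obtain ⟨z, hz, hpos, hmax⟩ := exists_maximizer r S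
  refine (hmax y hy).trans ?_
  have hsum := sum_inv_minimalElems_eq_one r hS hz hpos hmax
  have hMS : minimalElems r S ⊆ S := Finset.filter_subset _ _
  set M := minimalElems r S
  have hp : ∀ i ∈ M, 0 < (z i)⁻¹ := fun i hi => inv_pos.2 (hpos i (hMS hi))
  have hone : ∀ i ∈ M, 1 ≤ z i := by
    intro i hi
    have h : (z i)⁻¹ ≤ 1 := hsum ▸ Finset.single_le_sum (fun j hj => (hp j hj).le) hi
    exact (inv_le_one₀ (hpos i (hMS hi))).1 h
  have hlt : ∀ b ∈ M, ∀ i ∈ M, i ≠ b → 1 < z i := by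
    intro b hb i hi hib
    have h := Finset.add_le_sum (fun j hj => (hp j hj).le) hi hb hib
    rw [hsum] at h
    exact (inv_lt_one₀ (hpos i (hMS hi))).1 (by linarith [hp b hb])
  let w : α → ℝ := fun i => z i - if i ∈ M then 1 else 0
  have hw : ∀ b ∈ M, ∀ i ∈ S.erase b, 0 < w i := by
    intro b hb i hi
    obtain ⟨hib, hiS⟩ := Finset.mem_erase.1 hi
    simp only [w]
    split_ifs with h
    · linarith [hlt b hb i h hib]
    · linarith [hpos i hiS]
  have hlogw : ∀ b ∈ M, ∀ i ∈ S.erase b,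
      Real.log (w i) = Real.log (z i) + if i ∈ M then Real.log (1 - (z i)⁻¹) else 0 := by
    intro b hb i hi
    obtain ⟨hib, hiS⟩ := Finset.mem_erase.1 hi
    have hzi := hpos i hiS
    simp only [w]
    split_ifs with h
    · have h1 := hlt b hb i h hib
      rw [← Real.log_mul hzi.ne' (sub_pos.2 (inv_lt_one_of_one_lt₀ h1)).ne', mul_sub,
        mul_inv_cancel₀ hzi.ne', mul_one]
    · simp
  have hbound : ∀ b ∈ M, ∏ i ∈ S.erase b, w i ≤ ((listExts r (S.erase b)).card : ℝ) ^ 2 := by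
    intro b hb
    refine ih _ (Finset.erase_ssubset (hMS hb)) w ⟨fun i hi => (hw b hb i hi).le, fun C hC => ?_⟩
    have h := sum_sub_minimalElems_le r hS hz.1 hz.2 hone
      (C := C) ⟨hC.1.trans (Finset.erase_subset _ _), hC.2⟩
    rwa [Finset.cast_card_erase_of_mem (hMS hb)]
  have hcard : ∀ b ∈ M, (0 : ℝ) < (listExts r (S.erase b)).card := by
    intro b hb
    have h := (Finset.prod_pos (hw b hb)).trans_le (hbound b hb)
    exact lt_of_le_of_ne (Nat.cast_nonneg _) fun h0 => by simp [← h0] at h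
  have hlog : ∀ b ∈ M, ∑ i ∈ S, Real.log (z i) - Real.log (z b)
      + (∑ i ∈ M, Real.log (1 - (z i)⁻¹) - Real.log (1 - (z b)⁻¹))
      ≤ 2 * Real.log (listExts r (S.erase b)).card := by
    intro b hb
    have h := Real.log_le_log (Finset.prod_pos (hw b hb)) (hbound b hb)
    rw [Real.log_prod fun i hi => (hw b hb i hi).ne', Real.log_pow,
      Finset.sum_congr rfl (hlogw b hb), Finset.sum_add_distrib] at h
    have h1 := Finset.add_sum_erase S (fun i => Real.log (z i)) (hMS hb)
    have h2 := Finset.add_sum_erase S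
      (fun i => if i ∈ M then Real.log (1 - (z i)⁻¹) else 0) (hMS hb)
    rw [Finset.sum_ite_mem S, Finset.inter_eq_right.2 hMS] at h2
    simp only [hb, if_true] at h2
    push_cast at h
    linarith
  have hjensen : ∑ b ∈ M, (z b)⁻¹ * (Real.log (listExts r (S.erase b)).card + Real.log (z b))
      ≤ Real.log (∑ b ∈ M, ((listExts r (S.erase b)).card : ℝ)) := by
    have h := strictConcaveOn_log_Ioi.concaveOn.le_map_sum (t := M) (w := fun b => (z b)⁻¹)
      (p := fun b => ((listExts r (S.erase b)).card : ℝ) * z b)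
      (fun b hb => (hp b hb).le) hsum (fun b hb => mul_pos (hcard b hb) (hpos b (hMS hb)))
    simp only [smul_eq_mul] at h
    rw [Finset.sum_congr rfl fun b hb => by
      rw [Real.log_mul (hcard b hb).ne' (hpos b (hMS hb)).ne']] at h
    refine h.trans_eq (congrArg Real.log (Finset.sum_congr rfl fun b hb => ?_))
    have := (hpos b (hMS hb)).ne'
    field_simp
  have hMne : M.Nonempty := by
    by_contra h
    rw [Finset.not_nonempty_iff_eq_empty] at h
    simp [h] at hsum
  have hsumpos : (0 : ℝ) < ∑ b ∈ M, ((listExts r (S.erase b)).card : ℝ) :=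
    Finset.sum_pos hcard hMne
  have hle : ∑ b ∈ M, ((listExts r (S.erase b)).card : ℝ) ≤ (listExts r S).card := by
    exact_mod_cast sum_card_listExts_erase_le r S
  have hentropy := sum_mul_entropySkew_nonneg M (fun i => (z i)⁻¹) hp hsum
  have hmain : ∑ i ∈ S, Real.log (z i) ≤ 2 * ∑ b ∈ M, (z b)⁻¹ *
      (Real.log (listExts r (S.erase b)).card + Real.log (z b)) := by
    set L := ∑ i ∈ S, Real.log (z i)
    set Q := ∑ i ∈ M, Real.log (1 - (z i)⁻¹) with hQ
    have h1 : ∑ b ∈ M, ((z b)⁻¹ * (L + Q)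
        + ((z b)⁻¹ * entropySkew (z b)⁻¹ - Real.log (1 - (z b)⁻¹))) ≤
        ∑ b ∈ M, 2 * ((z b)⁻¹ * (Real.log (listExts r (S.erase b)).card + Real.log (z b))) := by
      refine Finset.sum_le_sum fun b hb => ?_
      have h := mul_le_mul_of_nonneg_left (hlog b hb) (hp b hb).le
      rw [mul_entropySkew, Real.log_inv]
      linarith
    rw [Finset.sum_add_distrib, Finset.sum_sub_distrib, ← Finset.sum_mul, hsum, ← hQ,
      ← Finset.mul_sum] at h1
    linarith
  have hE := hsumpos.trans_le hle
  rw [← Real.log_le_log_iff (Finset.prod_pos hpos) (by positivity), Real.log_pow,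
    Real.log_prod fun i hi => (hpos i hi).ne']
  push_cast
  linarith [Real.log_le_log hsumpos hle]

end Extensions

/-- Cardinal et al.. `n (ln n − H(P)) ≤ 2 ln |Δ(P)|`. -/
theorem stmt_3 (n : ℕ) (r : Fin n → Fin n → Prop) [IsPartialOrder (Fin n) r] :
    (n : ℝ) * (Real.log n - posetEntropy (Fin n) r) ≤
      2 * Real.log ((linExts (Fin n) r).card) := by
  rcases Nat.eq_zero_or_pos n with rfl | hn
  · simpa using Real.log_natCast_nonneg _
  have hn' : (0 : ℝ) < n := by exact_mod_cast hn
  set e : ℝ := ((linExts (Fin n) r).card : ℝ) with he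
  suffices h : Real.log n - 2 * Real.log e / n ≤ posetEntropy (Fin n) r by
    have h1 := mul_le_mul_of_nonneg_left h hn'.le
    rw [mul_sub, mul_div_cancel₀ _ hn'.ne'] at h1
    linarith
  refine le_csInf ⟨_, fun _ => (n : ℝ)⁻¹, ⟨fun _ => by positivity, fun C _ => ?_⟩,
    fun _ => by positivity, rfl⟩ ?_
  · rw [Finset.sum_const, nsmul_eq_mul, ← div_eq_mul_inv, div_le_one hn']
    exact_mod_cast (Finset.card_le_univ C).trans_eq (Fintype.card_fin n)
  rintro x ⟨z, hz, hpos, rfl⟩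
  have hmem : (fun i => n * z i) ∈ chainBody r Finset.univ (Finset.univ : Finset (Fin n)).card := by
    refine ⟨fun i _ => by have := hpos i; positivity, fun C hC => ?_⟩
    rw [← Finset.mul_sum, Finset.card_univ, Fintype.card_fin]
    exact mul_le_of_le_one_right hn'.le (hz.2 C hC.2)
  have hprod : ∏ i, (n * z i) ≤ e ^ 2 := (prod_le_sq_card_listExts r _ _ hmem).trans
    (pow_le_pow_left₀ (Nat.cast_nonneg _) (Nat.cast_le.2 (card_listExts_le_card_linExts r)) 2)
  have hlog := Real.log_le_log (Finset.prod_pos fun i _ => mul_pos hn' (hpos i)) hprod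
  rw [Real.log_prod fun i _ => (mul_pos hn' (hpos i)).ne', Real.log_pow,
    Finset.sum_congr rfl fun i _ => Real.log_mul hn'.ne' (hpos i).ne',
    Finset.sum_add_distrib, Finset.sum_const, Finset.card_univ, Fintype.card_fin,
    nsmul_eq_mul] at hlog
  push_cast at hlog
  rw [Fintype.card_fin, sub_le_iff_le_add, ← mul_le_mul_iff_right₀ hn']
  field_simp
  linarith
end

section
/- Let P be a partially ordered set on the ground set [n] = {1,...,n}. Then QLB(P) = n · (H_n − QH(P)), where QLB(P) = E_{σ uniform in Δ(P)}[ sum_{i in [n]} H_{d_i(σ)−1} ] and QH(P) = E_{z uniform in C(P)}[ −(1/n) sum_{i in [n]} ln z_i ]. -/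
open MeasureTheory Finset

attribute [local instance] Classical.propDecidable

/-- The open simplex `0 < u 0 < ⋯ < u (n - 1) < 1`. -/
def openSimplex (n : ℕ) : Set (Fin n → ℝ) :=
  {u | StrictMono u ∧ ∀ i, 0 < u i ∧ u i < 1}

/-- The sequence `0, u 0, …, u (n - 1), 1, 1, …`. -/
noncomputable def padded {n : ℕ} (u : Fin n → ℝ) (k : ℕ) : ℝ :=
  if k = 0 then 0 else if h : k - 1 < n then u ⟨k - 1, h⟩ else 1

lemma padded_zero {n : ℕ} (u : Fin n → ℝ) : padded u 0 = 0 := by simp [padded]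

lemma padded_succ {n : ℕ} (u : Fin n → ℝ) (i : Fin n) : padded u (i + 1) = u i := by
  simp [padded]

lemma padded_of_lt {n : ℕ} (u : Fin n → ℝ) {k : ℕ} (hk : n < k) : padded u k = 1 := by
  have h1 : k ≠ 0 := by omega
  have h2 : ¬ k - 1 < n := by omega
  simp [padded, h1, h2]

lemma measurable_padded {n : ℕ} (k : ℕ) : Measurable fun u : Fin n → ℝ => padded u k := by
  unfold padded
  split_ifs <;> fun_prop

lemma padded_nonneg {n : ℕ} {u : Fin n → ℝ} (hu : u ∈ openSimplex n) (k : ℕ) :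
    0 ≤ padded u k := by
  unfold padded
  split_ifs
  · exact le_rfl
  · exact (hu.2 _).1.le
  · exact zero_le_one

lemma padded_le_one {n : ℕ} {u : Fin n → ℝ} (hu : u ∈ openSimplex n) (k : ℕ) :
    padded u k ≤ 1 := by
  unfold padded
  split_ifs
  · exact zero_le_one
  · exact (hu.2 _).2.le
  · exact le_rfl

lemma padded_lt_padded {n : ℕ} {u : Fin n → ℝ} (hu : u ∈ openSimplex n) {a b : ℕ}
    (hab : a < b) (hb : b ≤ n + 1) : padded u a < padded u b := by
  unfold padded
  split_ifs with h1 h2 h3 h4 h5 h6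
  · omega
  · exact (hu.2 _).1
  · exact zero_lt_one
  · omega
  · exact hu.1 (by rw [Fin.lt_def]; dsimp only; omega)
  · exact (hu.2 _).2
  · omega
  · omega
  · omega

lemma measurableSet_openSimplex (n : ℕ) : MeasurableSet (openSimplex n) := by
  have : openSimplex n = (⋂ i : Fin n, ⋂ j : Fin n, ⋂ _ : i < j, {u : Fin n → ℝ | u i < u j}) ∩
      ⋂ i : Fin n, {u : Fin n → ℝ | 0 < u i ∧ u i < 1} := by
    ext u
    simp [openSimplex, StrictMono]
  rw [this]
  refine MeasurableSet.inter (MeasurableSet.iInter fun i => MeasurableSet.iInter fun j =>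
    MeasurableSet.iInter fun _ => measurableSet_lt (measurable_pi_apply i) (measurable_pi_apply j))
    (MeasurableSet.iInter fun i => ?_)
  exact (measurableSet_lt measurable_const (measurable_pi_apply i)).inter
    (measurableSet_lt (measurable_pi_apply i) measurable_const)

lemma snoc_smul_mem_openSimplex {n : ℕ} {t : ℝ} (ht : t ∈ Set.Ioo (0 : ℝ) 1) (v : Fin n → ℝ) :
    (Fin.snoc (t • v) t : Fin (n + 1) → ℝ) ∈ openSimplex (n + 1) ↔ v ∈ openSimplex n := by
  obtain ⟨h0, h1⟩ := ht
  constructor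
  · rintro ⟨hm, hb⟩
    refine ⟨fun i j hij => ?_, fun i => ⟨?_, ?_⟩⟩
    · have := hm (Fin.castSucc_lt_castSucc_iff.2 hij)
      simp only [Fin.snoc_castSucc, Pi.smul_apply, smul_eq_mul] at this
      exact lt_of_mul_lt_mul_left this h0.le
    · have := (hb i.castSucc).1
      simp only [Fin.snoc_castSucc, Pi.smul_apply, smul_eq_mul] at this
      exact pos_of_mul_pos_right this h0.le
    · have := hm (Fin.castSucc_lt_last i)
      simp only [Fin.snoc_castSucc, Fin.snoc_last, Pi.smul_apply, smul_eq_mul] at this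
      nlinarith
  · rintro ⟨hm, hb⟩
    refine ⟨fun i j => ?_, fun i => ?_⟩
    · induction j using Fin.lastCases with
      | last =>
        induction i using Fin.lastCases with
        | last => simp
        | cast i =>
          intro _
          simp only [Fin.snoc_castSucc, Fin.snoc_last, Pi.smul_apply, smul_eq_mul]
          nlinarith [hb i]
      | cast j =>
        induction i using Fin.lastCases with
        | last => intro h; exact absurd h (Fin.castSucc_lt_last j).not_gt
        | cast i =>
          intro h
          simp only [Fin.snoc_castSucc, Pi.smul_apply, smul_eq_mul]
          exact mul_lt_mul_of_pos_left (hm (Fin.castSucc_lt_castSucc_iff.1 h)) h0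
    · induction i using Fin.lastCases with
      | last => simp [h0, h1]
      | cast i =>
        simp only [Fin.snoc_castSucc, Pi.smul_apply, smul_eq_mul]
        have := hb i
        constructor <;> nlinarith

lemma padded_snoc_smul {n : ℕ} (t : ℝ) (v : Fin n → ℝ) {k : ℕ} (hk : k ≤ n + 1) :
    padded (Fin.snoc (t • v) t : Fin (n + 1) → ℝ) k = t * padded v k := by
  rcases k with _ | k
  · simp [padded_zero]
  · rcases (Nat.succ_le_succ_iff.1 hk).lt_or_eq with h | rfl
    · have h1 := padded_succ (Fin.snoc (t • v) t : Fin (n + 1) → ℝ) (Fin.castSucc ⟨k, h⟩)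
      have h2 := padded_succ v ⟨k, h⟩
      simp only [Fin.snoc_castSucc, Pi.smul_apply, smul_eq_mul] at h1
      rw [← h2] at h1
      exact h1
    · have h1 := padded_succ (Fin.snoc (t • v) t : Fin (k + 1) → ℝ) (Fin.last k)
      rw [padded_of_lt v (Nat.lt_succ_self k), mul_one]
      simpa using h1

lemma lintegral_eq_pow_mul_lintegral_smul {n : ℕ} {t : ℝ} (ht : 0 < t) {g : (Fin n → ℝ) → ENNReal}
    (hg : Measurable g) :
    ∫⁻ w, g w = ENNReal.ofReal (t ^ n) * ∫⁻ v, g (t • v) := by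
  have h := Measure.map_addHaar_smul (volume : Measure (Fin n → ℝ)) ht.ne'
  have h2 : ∫⁻ v, g (t • v) = ∫⁻ w, g w ∂(Measure.map (t • ·) (volume : Measure (Fin n → ℝ))) :=
    (lintegral_map hg (measurable_const_smul t)).symm
  rw [h2, h, lintegral_smul_measure, smul_eq_mul, ← mul_assoc, ← ENNReal.ofReal_mul (by positivity)]
  rw [Module.finrank_fin_fun, abs_of_pos (by positivity), mul_inv_cancel₀ (by positivity)]
  simp

lemma setLIntegral_openSimplex_succ {n : ℕ} {f : (Fin (n + 1) → ℝ) → ENNReal} (hf : Measurable f) :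
    ∫⁻ u in openSimplex (n + 1), f u =
      ∫⁻ t in Set.Ioo (0 : ℝ) 1, ENNReal.ofReal (t ^ n) *
        ∫⁻ v in openSimplex n, f (Fin.snoc (t • v) t : Fin (n + 1) → ℝ) := by
  have hmp := (volume_preserving_piFinSuccAbove (fun _ : Fin (n + 1) => ℝ) (Fin.last n)).symm
  have hsn : ∀ (t : ℝ) (w : Fin n → ℝ),
      (MeasurableEquiv.piFinSuccAbove (fun _ : Fin (n + 1) => ℝ) (Fin.last n)).symm (t, w) =
        (Fin.snoc w t : Fin (n + 1) → ℝ) := by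
    intro t w
    simp [MeasurableEquiv.piFinSuccAbove, Fin.insertNthEquiv, Fin.insertNth_last']
  set F := (openSimplex (n + 1)).indicator f with hF
  have hFm : Measurable F := hf.indicator (measurableSet_openSimplex _)
  rw [← lintegral_indicator (measurableSet_openSimplex _), ← hF,
    ← hmp.lintegral_comp hFm, Measure.volume_eq_prod,
    lintegral_prod _ (show Measurable fun p => F _ from hFm.comp hmp.measurable).aemeasurable,
    ← lintegral_indicator measurableSet_Ioo]
  refine lintegral_congr fun t => ?_
  by_cases ht : t ∈ Set.Ioo (0 : ℝ) 1
  · rw [Set.indicator_of_mem ht]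
    have hm : Measurable fun w : Fin n → ℝ => F ((MeasurableEquiv.piFinSuccAbove
        (fun _ : Fin (n + 1) => ℝ) (Fin.last n)).symm (t, w)) :=
      hFm.comp (hmp.measurable.comp measurable_prodMk_left)
    rw [lintegral_eq_pow_mul_lintegral_smul ht.1 hm,
      ← lintegral_indicator (measurableSet_openSimplex _)]
    congr 1
    refine lintegral_congr fun v => ?_
    rw [hsn, hF]
    by_cases hv : v ∈ openSimplex n
    · rw [Set.indicator_of_mem hv,
        Set.indicator_of_mem ((snoc_smul_mem_openSimplex ht v).2 hv)]
    · rw [Set.indicator_of_notMem hv,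
        Set.indicator_of_notMem (mt (snoc_smul_mem_openSimplex ht v).1 hv)]
  · rw [Set.indicator_of_notMem ht]
    refine (lintegral_congr fun w => ?_).trans lintegral_zero
    rw [hsn, hF, Set.indicator_of_notMem]
    intro h
    have := h.2 (Fin.last n)
    rw [Fin.snoc_last] at this
    exact ht this

lemma setLIntegral_pow (n : ℕ) :
    ∫⁻ t in Set.Ioo (0 : ℝ) 1, ENNReal.ofReal (t ^ n) = ENNReal.ofReal (1 / (n + 1)) := by
  rw [restrict_Ioo_eq_restrict_Ioc, ← ofReal_integral_eq_lintegral_ofReal,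
    ← intervalIntegral.integral_of_le zero_le_one, integral_pow]
  · simp
  · exact (continuous_pow n).integrableOn_Ioc
  · filter_upwards [ae_restrict_mem measurableSet_Ioc] with t ht
    exact pow_nonneg ht.1.le n

lemma setLIntegral_pow_mul_neg_log (n : ℕ) :
    ∫⁻ t in Set.Ioo (0 : ℝ) 1, ENNReal.ofReal (t ^ n * -Real.log t) =
      ENNReal.ofReal (1 / (n + 1) ^ 2) := by
  have hint : IntervalIntegrable (fun t : ℝ => t ^ n * -Real.log t) volume 0 1 :=
    intervalIntegral.intervalIntegrable_log'.neg.continuousOn_mul (by fun_prop)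
  have hn : (n + 1 : ℝ) ≠ 0 := by positivity
  have hI : ∫ t in (0 : ℝ)..1, t ^ n * -Real.log t = 1 / (n + 1) ^ 2 := by
    rw [intervalIntegral.integral_eq_sub_of_hasDerivAt_of_le
      (f := fun t => t ^ (n + 1) / (n + 1) ^ 2 - t ^ n * (t * Real.log t) / (n + 1))
      zero_le_one _ _ hint]
    · simp
    · have := Real.continuous_mul_log
      fun_prop
    · intro t ht
      have h1 := hasDerivAt_pow (n + 1) t
      have h2 := h1.mul (Real.hasDerivAt_log ht.1.ne')
      have h3 := (h1.div_const ((n + 1 : ℝ) ^ 2)).sub (h2.div_const (n + 1 : ℝ))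
      have ht' := ht.1.ne'
      refine (h3.congr_deriv ?_).congr_of_eventuallyEq (Filter.Eventually.of_forall fun x => ?_)
      · push_cast
        field_simp
        ring
      · change x ^ (n + 1) / ((n : ℝ) + 1) ^ 2 - x ^ n * (x * Real.log x) / (n + 1) =
          x ^ (n + 1) / ((n : ℝ) + 1) ^ 2 - x ^ (n + 1) * Real.log x / (n + 1)
        ring
  rw [restrict_Ioo_eq_restrict_Ioc, ← ofReal_integral_eq_lintegral_ofReal,
    ← intervalIntegral.integral_of_le zero_le_one, hI]
  · exact (intervalIntegrable_iff_integrableOn_Ioc_of_le zero_le_one).1 hint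
  · filter_upwards [ae_restrict_mem measurableSet_Ioc] with t ht
    exact mul_nonneg (pow_nonneg ht.1.le n) (neg_nonneg.2 (Real.log_nonpos ht.1.le ht.2))

lemma volume_openSimplex (n : ℕ) :
    volume (openSimplex n) = ENNReal.ofReal (1 / n.factorial) := by
  induction n with
  | zero =>
    have : openSimplex 0 = Set.univ := by
      ext u
      simp [openSimplex, StrictMono]
    simp [this, volume_pi]
  | succ n ih =>
    rw [← setLIntegral_one, setLIntegral_openSimplex_succ measurable_const]
    simp only [setLIntegral_one, ih]
    rw [lintegral_mul_const _ (by fun_prop), setLIntegral_pow, ← ENNReal.ofReal_mul (by positivity)]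
    congr 1
    rw [Nat.factorial_succ]
    push_cast
    field_simp

lemma harm_succ (q : ℕ) : harm (q + 1) = harm q + 1 / (q + 1) := by
  simp [harm, Finset.sum_range_succ]

lemma monotone_harm : Monotone harm :=
  monotone_nat_of_le_succ fun q => by
    rw [harm_succ]
    have : (0 : ℝ) ≤ 1 / (q + 1) := by positivity
    linarith

lemma measurePreserving_one_sub_comp_rev (n : ℕ) :
    MeasurePreserving (fun (u : Fin n → ℝ) (i : Fin n) => 1 - u i.rev) := by
  have h1 := volume_measurePreserving_piCongrLeft (fun _ : Fin n => ℝ) Fin.revPerm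
  have h2 := Measure.measurePreserving_sub_left (volume : Measure (Fin n → ℝ)) 1
  have h3 : (fun (u : Fin n → ℝ) (i : Fin n) => 1 - u i.rev) =
      (fun u => 1 - u) ∘ MeasurableEquiv.piCongrLeft (fun _ : Fin n => ℝ) Fin.revPerm := by
    funext u i
    have := MeasurableEquiv.piCongrLeft_apply_apply (β := fun _ : Fin n => ℝ) Fin.revPerm u i.rev
    rw [Fin.revPerm_apply, Fin.rev_rev] at this
    simp [this]
  rw [h3]
  exact h2.comp h1

lemma one_sub_comp_rev_mem_openSimplex {n : ℕ} {u : Fin n → ℝ} :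
    (fun i => 1 - u i.rev) ∈ openSimplex n ↔ u ∈ openSimplex n := by
  have key : ∀ v : Fin n → ℝ, v ∈ openSimplex n → (fun i => 1 - v i.rev) ∈ openSimplex n := by
    intro v hv
    refine ⟨fun i j hij => ?_, fun i => ?_⟩
    · have := hv.1 (Fin.rev_lt_rev.2 hij)
      dsimp only
      linarith
    · have := hv.2 i.rev
      constructor <;> linarith
  refine ⟨fun h => ?_, key u⟩
  simpa using key _ h

lemma padded_one_sub_comp_rev {n : ℕ} (u : Fin n → ℝ) {k : ℕ} (hk : k ≤ n + 1) :
    padded (fun i => 1 - u i.rev) k = 1 - padded u (n + 1 - k) := by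
  rcases k with _ | k
  · rw [padded_zero, padded_of_lt u (by omega), sub_self]
  · rcases (Nat.succ_le_succ_iff.1 hk).lt_or_eq with h | rfl
    · have h1 := padded_succ (fun i => 1 - u i.rev) ⟨k, h⟩
      have h2 := padded_succ u (Fin.rev ⟨k, h⟩)
      simp only [Fin.val_rev] at h1 h2
      rw [h1, ← h2]
      congr 2
      omega
    · rw [padded_of_lt _ (by omega)]
      simp [padded_zero]

/-- The expected logarithm of the gap between two order statistics of `n` uniform variables. -/
lemma setLIntegral_neg_log_padded_sub (n : ℕ) {a b : ℕ} (hab : a < b) (hb : b ≤ n + 1) :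
    ∫⁻ u in openSimplex n, ENNReal.ofReal (-Real.log (padded u b - padded u a)) =
      ENNReal.ofReal ((harm n - harm (b - a - 1)) / n.factorial) := by
  have hmeas : ∀ (n a b : ℕ), Measurable fun u : Fin n → ℝ =>
      ENNReal.ofReal (-Real.log (padded u b - padded u a)) := fun n a b =>
    (((measurable_padded b).sub (measurable_padded a)).log.neg).ennreal_ofReal
  have full : ∀ n : ℕ, ∫⁻ u in openSimplex n,
      ENNReal.ofReal (-Real.log (padded u (n + 1) - padded u 0)) =
        ENNReal.ofReal ((harm n - harm (n + 1 - 0 - 1)) / n.factorial) := by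
    intro n
    simp [padded_zero, padded_of_lt]
  induction n generalizing a b with
  | zero =>
    obtain rfl : a = 0 := by omega
    obtain rfl : b = 1 := by omega
    exact full 0
  | succ n ih =>
    have step : ∀ {a b : ℕ}, a < b → b ≤ n + 1 → ∫⁻ u in openSimplex (n + 1),
        ENNReal.ofReal (-Real.log (padded u b - padded u a)) =
          ENNReal.ofReal ((harm (n + 1) - harm (b - a - 1)) / (n + 1).factorial) := by
      intro a b hab hb
      have hpos : 0 ≤ harm n - harm (b - a - 1) := sub_nonneg.2 (monotone_harm (by omega))
      rw [setLIntegral_openSimplex_succ (hmeas _ _ _)]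
      have inner : ∀ t ∈ Set.Ioo (0 : ℝ) 1, ENNReal.ofReal (t ^ n) * ∫⁻ v in openSimplex n,
          ENNReal.ofReal (-Real.log (padded (Fin.snoc (t • v) t : Fin (n + 1) → ℝ) b -
            padded (Fin.snoc (t • v) t : Fin (n + 1) → ℝ) a)) =
          ENNReal.ofReal (t ^ n * -Real.log t) * ENNReal.ofReal (1 / n.factorial) +
          ENNReal.ofReal (t ^ n) *
            ENNReal.ofReal ((harm n - harm (b - a - 1)) / n.factorial) := by
        intro t ht
        have : ∀ v ∈ openSimplex n,
            ENNReal.ofReal (-Real.log (padded (Fin.snoc (t • v) t : Fin (n + 1) → ℝ) b -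
              padded (Fin.snoc (t • v) t : Fin (n + 1) → ℝ) a)) =
            ENNReal.ofReal (-Real.log t) +
              ENNReal.ofReal (-Real.log (padded v b - padded v a)) := by
          intro v hv
          have h1 := padded_lt_padded hv hab hb
          have h2 := padded_le_one hv b
          have h3 := padded_nonneg hv a
          rw [padded_snoc_smul t v hb, padded_snoc_smul t v (by omega), ← mul_sub,
            Real.log_mul ht.1.ne' (by linarith), neg_add, ENNReal.ofReal_add]
          · exact neg_nonneg.2 (Real.log_nonpos ht.1.le ht.2.le)
          · exact neg_nonneg.2 (Real.log_nonpos (by linarith) (by linarith))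
        rw [setLIntegral_congr_fun (measurableSet_openSimplex n) this,
          lintegral_add_left measurable_const, setLIntegral_const, volume_openSimplex, ih hab hb,
          mul_add, ← mul_assoc, ← ENNReal.ofReal_mul (pow_nonneg ht.1.le n)]
      rw [setLIntegral_congr_fun measurableSet_Ioo inner,
        lintegral_add_right _ (by fun_prop), lintegral_mul_const _ (by fun_prop),
        lintegral_mul_const _ (by fun_prop), setLIntegral_pow, setLIntegral_pow_mul_neg_log,
        ← ENNReal.ofReal_mul (by positivity), ← ENNReal.ofReal_mul (by positivity),
        ← ENNReal.ofReal_add (by positivity) (by positivity)]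
      congr 1
      rw [harm_succ, Nat.factorial_succ]
      push_cast
      field_simp
      ring
    rcases hb.lt_or_eq with h | rfl
    · exact step hab (by omega)
    · rcases Nat.eq_zero_or_pos a with rfl | ha
      · exact full (n + 1)
      · have hmp := measurePreserving_one_sub_comp_rev (n + 1)
        have hpre : (fun (u : Fin (n + 1) → ℝ) (i : Fin (n + 1)) => 1 - u i.rev) ⁻¹' openSimplex (n + 1) =
            openSimplex (n + 1) := Set.ext fun u => one_sub_comp_rev_mem_openSimplex
        rw [← hmp.setLIntegral_comp_preimage (measurableSet_openSimplex _) (hmeas _ _ _), hpre]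
        simp only [padded_one_sub_comp_rev _ le_rfl, padded_one_sub_comp_rev _ hab.le]
        have := step (a := 0) (b := n + 1 + 1 - a) (by omega) (by omega)
        simpa [padded_zero] using this

lemma measurePreserving_update_sub {α : Type} [Fintype α] (i : α) {g : (α → ℝ) → ℝ} (hg : Measurable g)
    (hgi : ∀ y z : α → ℝ, (∀ j, j ≠ i → y j = z j) → g y = g z) :
    MeasurePreserving fun y : α → ℝ => Function.update y i (y i - g y) := by
  have e := volume_preserving_piEquivPiSubtypeProd (fun _ : α => ℝ) (fun j => j ≠ i)
  set E := MeasurableEquiv.piEquivPiSubtypeProd (fun _ : α => ℝ) (fun j => j ≠ i)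
  have hsk : MeasurePreserving (fun p : ({j // j ≠ i} → ℝ) × ({j // ¬ j ≠ i} → ℝ) =>
      (id p.1, p.2 - fun _ => g (E.symm (p.1, 0)))) (volume.prod volume) (volume.prod volume) := by
    refine (MeasurePreserving.id _).skew_product (g := fun a c => c - fun _ => g (E.symm (a, 0)))
      ?_ (Filter.Eventually.of_forall fun a => (measurePreserving_sub_right volume _).map_eq)
    refine measurable_snd.sub (measurable_pi_lambda _ fun _ => hg.comp (E.symm.measurable.comp ?_))
    exact measurable_fst.prodMk measurable_const
  convert (e.symm.comp hsk).comp e using 1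
  funext y
  have hgy : g (E.symm ((E y).1, 0)) = g y := hgi _ _ fun j hj => by
    simp [E, MeasurableEquiv.piEquivPiSubtypeProd, Equiv.piEquivPiSubtypeProd, hj]
  funext j
  simp only [Function.comp_apply, hgy, id]
  by_cases hj : j = i
  · subst hj
    simp [E, MeasurableEquiv.piEquivPiSubtypeProd, Equiv.piEquivPiSubtypeProd]
  · simp [E, MeasurableEquiv.piEquivPiSubtypeProd, Equiv.piEquivPiSubtypeProd, hj]

lemma exists_equiv_strictMono {α : Type} [Fintype α] {y : α → ℝ} (hy : Function.Injective y) :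
    ∃ σ : α ≃ Fin (Fintype.card α), StrictMono (y ∘ σ.symm) := by
  let e := Fintype.equivFin α
  refine ⟨e.trans (Tuple.sort (y ∘ e.symm)).symm, ?_⟩
  refine (Tuple.monotone_sort (y ∘ e.symm)).strictMono_of_injective ?_
  exact (hy.comp e.symm.injective).comp (Equiv.injective _)

lemma measurePreserving_comp_symm {α : Type} [Fintype α] (σ : α ≃ Fin (Fintype.card α)) :
    MeasurePreserving fun y : α → ℝ => y ∘ σ.symm := by
  have h : (fun y : α → ℝ => y ∘ σ.symm) =
      MeasurableEquiv.piCongrLeft (fun _ : Fin (Fintype.card α) => ℝ) σ := by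
    funext y k
    have := MeasurableEquiv.piCongrLeft_apply_apply
      (β := fun _ : Fin (Fintype.card α) => ℝ) σ y (σ.symm k)
    rw [Equiv.apply_symm_apply] at this
    exact this.symm
  rw [h]
  exact volume_measurePreserving_piCongrLeft (fun _ : Fin (Fintype.card α) => ℝ) σ

lemma ae_injective_and_ne {α : Type} [Fintype α] :
    ∀ᵐ y : α → ℝ, Function.Injective y ∧ ∀ i, y i ≠ 0 ∧ y i ≠ 1 := by
  have h1 : ∀ i j : α, i ≠ j → ∀ᵐ y : α → ℝ, y i ≠ y j := by
    intro i j hij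
    let L : (α → ℝ) →ₗ[ℝ] ℝ :=
      (LinearMap.proj i : (α → ℝ) →ₗ[ℝ] ℝ) - LinearMap.proj j
    have hL : LinearMap.ker L ≠ ⊤ := by
      intro h
      have : L (Pi.single i 1) = 0 := LinearMap.mem_ker.1 (h ▸ Submodule.mem_top)
      simp [L, hij.symm] at this
    refine measure_mono_null (fun y hy => ?_)
      (Measure.addHaar_submodule (volume : Measure (α → ℝ)) (LinearMap.ker L) hL)
    have hy' : y i = y j := by simpa using hy
    simp [L, hy']
  have h2 : ∀ (i : α) (c : ℝ), ∀ᵐ y : α → ℝ, y i ≠ c := fun i c =>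
    Measure.ae_eval_ne (fun _ : α => (volume : Measure ℝ)) i c
  have h1' : ∀ᵐ y : α → ℝ, ∀ i j, i ≠ j → y i ≠ y j := by
    simp only [ae_all_iff]
    exact h1
  have h2' : ∀ᵐ y : α → ℝ, ∀ i, y i ≠ 0 ∧ y i ≠ 1 :=
    ae_all_iff.2 fun i => (h2 i 0).and (h2 i 1)
  filter_upwards [h1', h2'] with y hy hy'
  exact ⟨fun i j hij => by_contra fun hne => hy i j hne hij, hy'⟩

lemma pairwiseDisjoint_regions {α : Type} [Fintype α] (s : Set (α ≃ Fin (Fintype.card α))) :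
    s.PairwiseDisjoint fun σ => {y : α → ℝ | y ∘ σ.symm ∈ openSimplex (Fintype.card α)} := by
  intro σ _ τ _ hne
  refine Set.disjoint_left.2 fun y hσ hτ => hne ?_
  have h : y ∘ σ.symm = y ∘ τ.symm := (hσ.1.range_inj hτ.1).1 (by
    rw [σ.symm.surjective.range_comp, τ.symm.surjective.range_comp])
  have hinj : Function.Injective y := by
    have := hσ.1.injective.comp σ.injective
    simpa [Function.comp_assoc] using this
  have hsymm : σ.symm = τ.symm := Equiv.ext fun k => hinj (congrFun h k)
  simpa using congrArg Equiv.symm hsymm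

section

variable {α : Type} [Fintype α] [PartialOrder α]

/-- The larger of `0` and the largest value of `y` strictly below `i`. -/
noncomputable def lowerMax (y : α → ℝ) (i : α) : ℝ :=
  ((Finset.univ.filter (· < i)).sup fun j => (y j).toNNReal : NNReal)

lemma lowerMax_nonneg (y : α → ℝ) (i : α) : 0 ≤ lowerMax y i := NNReal.coe_nonneg _

lemma le_lowerMax (y : α → ℝ) {i j : α} (h : j < i) : y j ≤ lowerMax y i := by
  refine (Real.le_coe_toNNReal _).trans (NNReal.coe_le_coe.2 ?_)
  exact Finset.le_sup (f := fun j => (y j).toNNReal) (by simpa using h)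

lemma lowerMax_le {y : α → ℝ} {i : α} {b : ℝ} (hb : 0 ≤ b) (h : ∀ j < i, y j ≤ b) :
    lowerMax y i ≤ b := by
  rw [← Real.coe_toNNReal b hb]
  refine NNReal.coe_le_coe.2 (Finset.sup_le fun j hj => Real.toNNReal_le_toNNReal (h j ?_))
  simpa using hj

lemma lowerMax_congr {y z : α → ℝ} {i : α} (h : ∀ j < i, y j = z j) :
    lowerMax y i = lowerMax z i := by
  unfold lowerMax
  congr 1
  refine Finset.sup_congr rfl fun j hj => ?_
  rw [h j (by simpa using hj)]

lemma measurable_lowerMax (i : α) : Measurable fun y : α → ℝ => lowerMax y i := by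
  unfold lowerMax
  refine Measurable.coe_nnreal_real ?_
  have : ∀ s : Finset α, Measurable fun y : α → ℝ => s.sup fun j => (y j).toNNReal := by
    intro s
    induction s using Finset.induction_on with
    | empty => simp [measurable_const]
    | insert a s _ ih =>
      simp only [Finset.sup_insert]
      exact (measurable_pi_apply a).real_toNNReal.sup ih
  exact this _

/-- The transfer map, applied only to the coordinates in `s`. -/
noncomputable def partialTransfer (s : Finset α) (y : α → ℝ) (i : α) : ℝ :=
  if i ∈ s then y i - lowerMax y i else y i

lemma measurePreserving_partialTransfer (s : Finset α) (hs : IsUpperSet (s : Set α)) :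
    MeasurePreserving (partialTransfer s) := by
  induction s using Finset.strongInduction with
  | H s ih =>
    rcases s.eq_empty_or_nonempty with rfl | hne
    · have : partialTransfer (∅ : Finset α) = id := by
        funext y i
        simp [partialTransfer]
      rw [this]
      exact MeasurePreserving.id _
    · obtain ⟨i, his, hmin⟩ := s.exists_minimal hne
      have hup : IsUpperSet ((s.erase i : Finset α) : Set α) := by
        intro a b hab ha
        simp only [Finset.coe_erase, Set.mem_sdiff, Finset.mem_coe, Set.mem_singleton_iff] at ha ⊢
        refine ⟨hs hab ha.1, ?_⟩
        rintro rfl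
        exact ha.2 (le_antisymm hab (hmin ha.1 hab))
      have h1 := ih (s.erase i) (Finset.erase_ssubset his) hup
      have h2 := measurePreserving_update_sub i (measurable_lowerMax i) fun y z h =>
        lowerMax_congr fun j hj => h j hj.ne
      convert h2.comp h1 using 1
      funext y j
      have hl : lowerMax (partialTransfer (s.erase i) y) i = lowerMax y i := by
        refine lowerMax_congr fun k hk => ?_
        have : k ∉ s := fun hks => hk.not_ge (hmin hks hk.le)
        simp [partialTransfer, this]
      by_cases hj : j = i
      · subst hj
        simp [hl]
        simp [partialTransfer, his]
      · simp [partialTransfer, hj]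

/-- Stanley's transfer map, extended to the whole space. -/
noncomputable def fullTransfer (y : α → ℝ) (i : α) : ℝ := y i - lowerMax y i

lemma measurePreserving_fullTransfer :
    MeasurePreserving (fullTransfer : (α → ℝ) → α → ℝ) := by
  convert measurePreserving_partialTransfer (Finset.univ : Finset α) 
    (by simpa using isUpperSet_univ) using 1
  funext y i
  simp [partialTransfer, fullTransfer]

lemma sum_fullTransfer_le (y : α → ℝ) (C : Finset α)
    (hC : ∀ i ∈ C, ∀ j ∈ C, i ≤ j ∨ j ≤ i) {b : ℝ} (hb : 0 ≤ b) (h : ∀ i ∈ C, y i ≤ b) :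
    ∑ i ∈ C, fullTransfer y i ≤ b := by
  induction C using Finset.strongInduction generalizing b with
  | H C ih =>
    rcases C.eq_empty_or_nonempty with rfl | hne
    · simpa using hb
    · obtain ⟨m, hm, hmax⟩ := C.exists_maximal hne
      have hrec := ih (C.erase m) (Finset.erase_ssubset hm)
        (fun i hi j hj => hC i (Finset.mem_of_mem_erase hi) j (Finset.mem_of_mem_erase hj))
        (lowerMax_nonneg y m) fun j hj => le_lowerMax y <| by
          have hj' := Finset.mem_of_mem_erase hj
          refine lt_of_le_of_ne ?_ (Finset.ne_of_mem_erase hj)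
          exact (hC j hj' m hm).elim id (hmax hj')
      rw [← Finset.add_sum_erase C _ hm]
      have := h m hm
      unfold fullTransfer at hrec ⊢
      linarith

lemma exists_chain_sum_fullTransfer {y : α → ℝ} (hy : ∀ i, 0 ≤ y i) (i : α) :
    ∃ C : Finset α, (∀ j ∈ C, ∀ k ∈ C, j ≤ k ∨ k ≤ j) ∧ (∀ j ∈ C, j ≤ i) ∧
      ∑ j ∈ C, fullTransfer y j = y i := by
  induction i using WellFoundedLT.induction with
  | ind i ih =>
    by_cases hne : (Finset.univ.filter (· < i)).Nonempty
    · obtain ⟨j, hj, hsup⟩ := Finset.exists_mem_eq_sup _ hne fun j => (y j).toNNReal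
      have hji : j < i := by simpa using hj
      obtain ⟨C, hC, hle, hsum⟩ := ih j hji
      have hlow : lowerMax y i = y j := by
        rw [lowerMax, hsup, Real.coe_toNNReal _ (hy j)]
      have hi : i ∉ C := fun h => (hle i h).not_gt hji
      refine ⟨insert i C, ?_, ?_, ?_⟩
      · intro a ha b hb
        rcases Finset.mem_insert.1 ha with ha' | ha' <;>
          rcases Finset.mem_insert.1 hb with hb' | hb'
        · exact Or.inl (ha'.trans hb'.symm).le
        · exact Or.inr (ha' ▸ (hle b hb').trans hji.le)
        · exact Or.inl (hb' ▸ (hle a ha').trans hji.le)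
        · exact hC a ha' b hb'
      · intro a ha
        rcases Finset.mem_insert.1 ha with rfl | ha
        · exact le_rfl
        · exact (hle a ha).trans hji.le
      · rw [Finset.sum_insert hi, hsum, fullTransfer, hlow, sub_add_cancel]
    · refine ⟨{i}, by simp, by simp, ?_⟩
      have : lowerMax y i = 0 := by
        rw [lowerMax, Finset.not_nonempty_iff_eq_empty.1 hne]
        simp
      simp [fullTransfer, this]

lemma preimage_fullTransfer_chainPolytope :
    fullTransfer ⁻¹' chainPolytope α (· ≤ ·) = orderPolytope α (· ≤ ·) := by
  ext y
  constructor
  · rintro ⟨h0, h1⟩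
    have hle : ∀ i, lowerMax y i ≤ y i := fun i => sub_nonneg.1 (h0 i)
    have hpos : ∀ i, 0 ≤ y i := fun i => (lowerMax_nonneg y i).trans (hle i)
    refine ⟨fun i => ⟨hpos i, ?_⟩, fun i j hij => ?_⟩
    · obtain ⟨C, hC, -, hsum⟩ := exists_chain_sum_fullTransfer hpos i
      exact hsum ▸ h1 C hC
    · rcases hij.eq_or_lt with rfl | hlt
      · exact le_rfl
      · exact (le_lowerMax y hlt).trans (hle j)
  · rintro ⟨h0, h1⟩
    refine ⟨fun i => sub_nonneg.2 (lowerMax_le (h0 i).1 fun j hj => h1 j i hj.le), fun C hC => ?_⟩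
    exact sum_fullTransfer_le y C hC zero_le_one fun i _ => (h0 i).2

lemma measurableSet_chainPolytope : MeasurableSet (chainPolytope α (· ≤ ·)) := by
  have : chainPolytope α (· ≤ ·) = (⋂ i, {y : α → ℝ | 0 ≤ y i}) ∩
      ⋂ C : Finset α, ⋂ _ : ∀ i ∈ C, ∀ j ∈ C, i ≤ j ∨ j ≤ i,
        {y : α → ℝ | ∑ i ∈ C, y i ≤ 1} := by
    ext y
    simp [chainPolytope]
  rw [this]
  refine MeasurableSet.inter (MeasurableSet.iInter fun i =>
      measurableSet_le measurable_const (measurable_pi_apply i))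
    (MeasurableSet.iInter fun C => MeasurableSet.iInter fun _ =>
      measurableSet_le (Finset.measurable_sum _ fun i _ => measurable_pi_apply i) measurable_const)

lemma setLIntegral_chainPolytope {G : (α → ℝ) → ENNReal} (hG : Measurable G) :
    ∫⁻ z in chainPolytope α (· ≤ ·), G z =
      ∫⁻ y in orderPolytope α (· ≤ ·), G (fullTransfer y) := by
  rw [← measurePreserving_fullTransfer.setLIntegral_comp_preimage measurableSet_chainPolytope hG,
    preimage_fullTransfer_chainPolytope]

lemma mem_linExts {σ : α ≃ Fin (Fintype.card α)} :
    σ ∈ linExts α (· ≤ ·) ↔ ∀ i j : α, i ≤ j → σ i ≤ σ j := by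
  simp [linExts]

lemma linExts_nonempty : (linExts α (· ≤ ·)).Nonempty := by
  let _ : Fintype (LinearExtension α) := ‹Fintype α›
  let e : Fin (Fintype.card α) ≃o LinearExtension α :=
    Fintype.orderIsoFinOfCardEq (LinearExtension α) rfl
  refine ⟨e.symm.toEquiv, mem_linExts.2 fun i j hij => ?_⟩
  exact e.symm.monotone (toLinearExtension.monotone hij)

/-- On the region of a linear extension `σ`, the transfer map at `i` is the gap of length
`dN σ i` ending at `σ i`. -/
lemma fullTransfer_eq_padded_sub {σ : α ≃ Fin (Fintype.card α)} (hσ : σ ∈ linExts α (· ≤ ·))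
    (i : α) : 0 < dN (· ≤ ·) σ i ∧ dN (· ≤ ·) σ i ≤ σ i + 1 ∧
      ∀ y : α → ℝ, y ∘ σ.symm ∈ openSimplex (Fintype.card α) →
        fullTransfer y i = padded (y ∘ σ.symm) (σ i + 1) -
          padded (y ∘ σ.symm) (σ i + 1 - dN (· ≤ ·) σ i) := by
  rw [mem_linExts] at hσ
  have hval : ∀ (y : α → ℝ) (j : α), padded (y ∘ σ.symm) (σ j + 1) = y j := fun y j => by
    rw [padded_succ, Function.comp_apply, Equiv.symm_apply_apply]
  by_cases h : ∀ j : α, j ≤ i → j = i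
  · rw [dN, if_pos h]
    refine ⟨Nat.succ_pos _, le_rfl, fun y _ => ?_⟩
    have : lowerMax y i = 0 := le_antisymm
      (lowerMax_le le_rfl fun j hj => absurd (h j hj.le) hj.ne) (lowerMax_nonneg y i)
    rw [Nat.sub_self, padded_zero, hval, fullTransfer, this]
  · rw [dN, if_neg h]
    push Not at h
    obtain ⟨k, hki, hk⟩ := h
    set s := {m : ℕ | ∃ j : α, j ≠ i ∧ j ≤ i ∧ m = (σ i : ℕ) - (σ j : ℕ)}
    obtain ⟨j, hj, hji, hs⟩ : sInf s ∈ s := Nat.sInf_mem ⟨_, k, hk, hki, rfl⟩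
    have hlt : ∀ l : α, l < i → (σ l : ℕ) < σ i := fun l hl =>
      lt_of_le_of_ne (hσ l i hl.le) fun he => hl.ne (σ.injective (Fin.ext he))
    have hj' := hlt j (lt_of_le_of_ne hji hj)
    refine ⟨by omega, by omega, fun y hy => ?_⟩
    have hidx : (σ i : ℕ) + 1 - sInf s = σ j + 1 := by omega
    have hlow : lowerMax y i = y j := by
      refine le_antisymm (lowerMax_le ?_ fun l hl => ?_) (le_lowerMax y (lt_of_le_of_ne hji hj))
      · rw [← hval y j]
        exact padded_nonneg hy _
      · have h1 : sInf s ≤ (σ i : ℕ) - σ l := Nat.sInf_le ⟨l, hl.ne, hl.le, rfl⟩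
        have h2 := hlt l hl
        have h3 : σ l ≤ σ j := by
          rw [Fin.le_def]
          omega
        simpa using hy.1.monotone h3
    rw [hidx, hval, hval, fullTransfer, hlow]

lemma orderPolytope_ae_eq_iUnion :
    orderPolytope α (· ≤ ·) =ᵐ[volume] ⋃ σ ∈ linExts α (· ≤ ·),
      {y : α → ℝ | y ∘ σ.symm ∈ openSimplex (Fintype.card α)} := by
  filter_upwards [ae_injective_and_ne (α := α)] with y hy
  refine propext (Iff.trans ?_ Set.mem_iUnion₂.symm)
  constructor
  · rintro ⟨h0, h1⟩
    obtain ⟨σ, hσ⟩ := exists_equiv_strictMono hy.1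
    refine ⟨σ, mem_linExts.2 fun i j hij => ?_, hσ, fun i => ⟨?_, ?_⟩⟩
    · have := h1 i j hij
      exact hσ.le_iff_le.1 (by simpa using this)
    · exact lt_of_le_of_ne (h0 _).1 (hy.2 _).1.symm
    · exact lt_of_le_of_ne (h0 _).2 (hy.2 _).2
  · rintro ⟨σ, hσ, hm, hb⟩
    refine ⟨fun i => ?_, fun i j hij => ?_⟩
    · have := hb (σ i)
      simp only [Function.comp_apply, Equiv.symm_apply_apply] at this
      exact ⟨this.1.le, this.2.le⟩
    · simpa using hm.monotone (mem_linExts.1 hσ i j hij)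

lemma setLIntegral_orderPolytope (F : (α → ℝ) → ENNReal) :
    ∫⁻ y in orderPolytope α (· ≤ ·), F y = ∑ σ ∈ linExts α (· ≤ ·),
      ∫⁻ y in {y : α → ℝ | y ∘ σ.symm ∈ openSimplex (Fintype.card α)}, F y := by
  rw [setLIntegral_congr orderPolytope_ae_eq_iUnion]
  exact lintegral_biUnion_finset (pairwiseDisjoint_regions _)
    (fun σ _ => (measurePreserving_comp_symm σ).measurable (measurableSet_openSimplex _)) F

lemma volume_chainPolytope :
    volume (chainPolytope α (· ≤ ·)) =
      ENNReal.ofReal ((linExts α (· ≤ ·)).card / (Fintype.card α).factorial) := by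
  rw [← setLIntegral_one, setLIntegral_chainPolytope measurable_const, setLIntegral_orderPolytope]
  simp only [setLIntegral_one]
  have : ∀ σ ∈ linExts α (· ≤ ·),
      volume {y : α → ℝ | y ∘ σ.symm ∈ openSimplex (Fintype.card α)} =
        ENNReal.ofReal (1 / (Fintype.card α).factorial) := fun σ _ => by
    rw [← volume_openSimplex]
    exact (measurePreserving_comp_symm σ).measure_preimage
      (measurableSet_openSimplex _).nullMeasurableSet
  rw [Finset.sum_congr rfl this, ← ENNReal.ofReal_sum_of_nonneg fun _ _ => by positivity]
  congr 1
  simp [div_eq_mul_inv]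

lemma harm_dN_le {σ : α ≃ Fin (Fintype.card α)} (hσ : σ ∈ linExts α (· ≤ ·)) (i : α) :
    harm (dN (· ≤ ·) σ i - 1) ≤ harm (Fintype.card α) := by
  obtain ⟨h0, h1, -⟩ := fullTransfer_eq_padded_sub hσ i
  have := (σ i).isLt
  exact monotone_harm (by omega)

lemma setLIntegral_chainPolytope_neg_log (i : α) :
    ∫⁻ z in chainPolytope α (· ≤ ·), ENNReal.ofReal (-Real.log (z i)) =
      ENNReal.ofReal (∑ σ ∈ linExts α (· ≤ ·),
        (harm (Fintype.card α) - harm (dN (· ≤ ·) σ i - 1)) / (Fintype.card α).factorial) := by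
  have hG : Measurable fun z : α → ℝ => ENNReal.ofReal (-Real.log (z i)) :=
    (measurable_pi_apply i).log.neg.ennreal_ofReal
  rw [setLIntegral_chainPolytope hG,
    setLIntegral_orderPolytope, ENNReal.ofReal_sum_of_nonneg fun σ hσ =>
      div_nonneg (sub_nonneg.2 (harm_dN_le hσ i)) (Nat.cast_nonneg _)]
  refine Finset.sum_congr rfl fun σ hσ => ?_
  obtain ⟨h0, h1, h2⟩ := fullTransfer_eq_padded_sub hσ i
  have hlt := (σ i).isLt
  have hmeas : Measurable fun u : Fin (Fintype.card α) → ℝ => ENNReal.ofReal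
      (-Real.log (padded u (σ i + 1) - padded u (σ i + 1 - dN (· ≤ ·) σ i))) :=
    (((measurable_padded _).sub (measurable_padded _)).log.neg).ennreal_ofReal
  have hmp := measurePreserving_comp_symm σ
  refine (setLIntegral_congr_fun (hmp.measurable (measurableSet_openSimplex _))
    fun y hy => by rw [h2 y hy]).trans ?_
  refine (hmp.setLIntegral_comp_preimage (measurableSet_openSimplex _) hmeas).trans ?_
  rw [setLIntegral_neg_log_padded_sub _ (by omega) (by omega)]
  congr 4
  omega

lemma mem_Icc_of_mem_chainPolytope {z : α → ℝ} (hz : z ∈ chainPolytope α (· ≤ ·)) (i : α) :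
    z i ∈ Set.Icc (0 : ℝ) 1 :=
  ⟨hz.1 i, by simpa using hz.2 {i} (by simp)⟩

lemma neg_log_nonneg_ae (i : α) :
    0 ≤ᵐ[volume.restrict (chainPolytope α (· ≤ ·))] fun z => -Real.log (z i) := by
  filter_upwards [ae_restrict_mem measurableSet_chainPolytope] with z hz
  have := mem_Icc_of_mem_chainPolytope hz i
  exact neg_nonneg.2 (Real.log_nonpos this.1 this.2)

lemma integrableOn_neg_log (i : α) :
    IntegrableOn (fun z : α → ℝ => -Real.log (z i)) (chainPolytope α (· ≤ ·)) := by
  refine ⟨(measurable_pi_apply i).log.neg.aestronglyMeasurable, ?_⟩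
  rw [hasFiniteIntegral_iff_ofReal (neg_log_nonneg_ae i), setLIntegral_chainPolytope_neg_log]
  exact ENNReal.ofReal_lt_top

lemma setIntegral_chainPolytope_neg_log (i : α) :
    ∫ z in chainPolytope α (· ≤ ·), -Real.log (z i) =
      ∑ σ ∈ linExts α (· ≤ ·),
        (harm (Fintype.card α) - harm (dN (· ≤ ·) σ i - 1)) / (Fintype.card α).factorial := by
  rw [integral_eq_lintegral_of_nonneg_ae (neg_log_nonneg_ae i)
    (measurable_pi_apply i).log.neg.aestronglyMeasurable, setLIntegral_chainPolytope_neg_log,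
    ENNReal.toReal_ofReal (Finset.sum_nonneg fun σ hσ =>
      div_nonneg (sub_nonneg.2 (harm_dN_le hσ i)) (Nat.cast_nonneg _))]

variable (α) in
theorem QLB_eq_card_mul_harm_sub_QH :
    QLB α (· ≤ ·) = (Fintype.card α : ℝ) * (harm (Fintype.card α) - QH α (· ≤ ·)) := by
  have hN : ((linExts α (· ≤ ·)).card : ℝ) ≠ 0 :=
    Nat.cast_ne_zero.2 (Finset.card_pos.2 linExts_nonempty).ne'
  have hf : ((Fintype.card α).factorial : ℝ) ≠ 0 :=
    Nat.cast_ne_zero.2 (Nat.factorial_ne_zero _)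
  rcases Nat.eq_zero_or_pos (Fintype.card α) with h0 | hpos
  · have := Fintype.card_eq_zero_iff.1 h0
    simp [QLB]
  have hc : (Fintype.card α : ℝ) ≠ 0 := Nat.cast_ne_zero.2 hpos.ne'
  have hint : ∫ z in chainPolytope α (· ≤ ·),
      -(1 / (Fintype.card α : ℝ)) * ∑ i : α, Real.log (z i) =
      1 / (Fintype.card α : ℝ) * ∑ i : α, ∑ σ ∈ linExts α (· ≤ ·),
        (harm (Fintype.card α) - harm (dN (· ≤ ·) σ i - 1)) / (Fintype.card α).factorial := by
    simp only [← setIntegral_chainPolytope_neg_log]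
    rw [← integral_finsetSum _ fun i _ => integrableOn_neg_log i, ← integral_const_mul]
    refine integral_congr_ae (Filter.Eventually.of_forall fun z => ?_)
    simp only [Finset.sum_neg_distrib]
    ring
  rw [QH, setAverage_eq, hint, Measure.real, volume_chainPolytope,
    ENNReal.toReal_ofReal (by positivity), Finset.sum_comm]
  simp only [← Finset.sum_div, Finset.sum_sub_distrib, Finset.sum_const, Finset.card_univ,
    nsmul_eq_mul, smul_eq_mul]
  rw [QLB]
  field_simp
  ring

end

/-- `QLB(P) = n (H_n − QH(P))`. -/
theorem stmt_5 (n : ℕ) (r : Fin n → Fin n → Prop) [IsPartialOrder (Fin n) r] :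
    QLB (Fin n) r = (n : ℝ) * (harm n - QH (Fin n) r) := by
  let po : PartialOrder (Fin n) :=
    { le := r
      lt := fun a b => r a b ∧ ¬ r b a
      le_refl := refl_of r
      le_trans := fun _ _ _ => trans_of r
      le_antisymm := fun _ _ => antisymm_of r }
  have h := @QLB_eq_card_mul_harm_sub_QH (Fin n) _ po
  rw [Fintype.card_fin] at h
  exact h
end

section
/- Let P and Q be posets on the disjoint ground sets {1,...,n1} and {n1+1,...,n1+n2} respectively, and let P ⊕ Q be their series composition. Then QLB(P ⊕ Q) = QLB(P) + QLB(Q). -/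
open MeasureTheory Finset

attribute [local instance] Classical.propDecidable

/-- Every finite partial order has a linear extension. -/
theorem linExts_nonempty_s6 (α : Type) [Fintype α] (r : α → α → Prop) [IsPartialOrder α r] :
    (linExts α r).Nonempty := by
  obtain ⟨t, ht, hrt⟩ := extend_partialOrder r
  let : LinearOrder α :=
    { le := t
      le_refl := fun a => ht.refl a
      le_trans := fun a b c => ht.trans a b c
      le_antisymm := fun a b => ht.antisymm a b
      le_total := fun a b => ht.total a b
      toDecidableLE := fun _ _ => Classical.propDecidable _ }
  refine ⟨(Fintype.orderIsoFinOfCardEq α rfl).symm.toEquiv, ?_⟩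
  simp only [linExts, mem_filter, mem_univ, true_and]
  intro i j hij
  exact (Fintype.orderIsoFinOfCardEq α rfl).symm.monotone (hrt i j hij)

/-- The concatenation of two labellings: the elements of `α` first, then those of `β`. -/
noncomputable def concatLabelling {α β : Type} [Fintype α] [Fintype β]
    (p : (α ≃ Fin (Fintype.card α)) × (β ≃ Fin (Fintype.card β))) :
    α ⊕ β ≃ Fin (Fintype.card (α ⊕ β)) :=
  ((Equiv.sumCongr p.1 p.2).trans finSumFinEquiv).trans (finCongr Fintype.card_sum.symm)

section Concat

variable {α β : Type} [Fintype α] [Fintype β]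

theorem concatLabelling_inl (p : (α ≃ Fin (Fintype.card α)) × (β ≃ Fin (Fintype.card β)))
    (x : α) : (concatLabelling p (Sum.inl x) : ℕ) = p.1 x := by
  simp [concatLabelling]

theorem concatLabelling_inr (p : (α ≃ Fin (Fintype.card α)) × (β ≃ Fin (Fintype.card β)))
    (y : β) : (concatLabelling p (Sum.inr y) : ℕ) = Fintype.card α + p.2 y := by
  simp [concatLabelling]

theorem concatLabelling_injective :
    Function.Injective (concatLabelling (α := α) (β := β)) := by
  intro p q h
  refine Prod.ext (Equiv.ext fun x => Fin.ext ?_) (Equiv.ext fun y => Fin.ext ?_)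
  · rw [← concatLabelling_inl, ← concatLabelling_inl, h]
  · have := congrArg (fun e => (e (Sum.inr y) : ℕ)) h
    simp only [concatLabelling_inr] at this
    omega

theorem concatLabelling_mem_linExts {r : α → α → Prop} {s : β → β → Prop}
    {p : (α ≃ Fin (Fintype.card α)) × (β ≃ Fin (Fintype.card β))}
    (hp : p ∈ linExts α r ×ˢ linExts β s) :
    concatLabelling p ∈ linExts (α ⊕ β) (seriesComp r s) := by
  simp only [linExts, mem_product, mem_filter, mem_univ, true_and] at hp ⊢
  rintro (i | i) (j | j) h
  · rw [Fin.le_def, concatLabelling_inl, concatLabelling_inl]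
    exact hp.1 i j h
  · have := (p.1 i).isLt
    rw [Fin.le_def, concatLabelling_inl, concatLabelling_inr]
    omega
  · exact h.elim
  · rw [Fin.le_def, concatLabelling_inr, concatLabelling_inr]
    exact Nat.add_le_add_left (hp.2 i j h) _

/-- If `ρ` puts every element of `α` before every element of `β`, then the elements of `α` occupy
exactly the first `Fintype.card α` positions. -/
theorem labelling_inl_lt_card (ρ : α ⊕ β ≃ Fin (Fintype.card (α ⊕ β)))
    (h : ∀ x y, ρ (Sum.inl x) < ρ (Sum.inr y)) (x : α) :
    (ρ (Sum.inl x) : ℕ) < Fintype.card α := by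
  have hsub : (Finset.Iic (ρ (Sum.inl x))) ⊆
      (Finset.univ : Finset α).image fun a => ρ (Sum.inl a) := by
    intro k hk
    obtain ⟨a | b, rfl⟩ := ρ.surjective k
    · exact mem_image_of_mem _ (mem_univ a)
    · exact absurd (mem_Iic.1 hk) (not_le.2 (h x b))
  have := (card_le_card hsub).trans card_image_le
  simpa [Fin.card_Iic, Nat.succ_le_iff] using this

theorem card_le_labelling_inr (ρ : α ⊕ β ≃ Fin (Fintype.card (α ⊕ β)))
    (h : ∀ x y, ρ (Sum.inl x) < ρ (Sum.inr y)) (y : β) :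
    Fintype.card α ≤ (ρ (Sum.inr y) : ℕ) := by
  have hsub : ((Finset.univ : Finset α).image fun a => ρ (Sum.inl a)) ⊆
      Finset.Iio (ρ (Sum.inr y)) := by
    intro k hk
    obtain ⟨a, -, rfl⟩ := mem_image.1 hk
    exact mem_Iio.2 (h a y)
  have := card_le_card hsub
  rw [card_image_of_injective _ fun a b hab => Sum.inl_injective (ρ.injective hab)] at this
  simpa [Fin.card_Iio] using this

theorem exists_concatLabelling_eq {r : α → α → Prop} {s : β → β → Prop}
    {ρ : α ⊕ β ≃ Fin (Fintype.card (α ⊕ β))} (hρ : ρ ∈ linExts (α ⊕ β) (seriesComp r s)) :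
    ∃ p ∈ linExts α r ×ˢ linExts β s, concatLabelling p = ρ := by
  simp only [linExts, mem_filter, mem_univ, true_and] at hρ
  have hlt : ∀ x y, ρ (Sum.inl x) < ρ (Sum.inr y) := fun x y =>
    lt_of_le_of_ne (hρ (Sum.inl x) (Sum.inr y) trivial) fun h => by
      simpa using ρ.injective h
  have hl := labelling_inl_lt_card ρ hlt
  have hr := card_le_labelling_inr ρ hlt
  have hr' (y : β) : (ρ (Sum.inr y) : ℕ) - Fintype.card α < Fintype.card β := by
    have h1 := (ρ (Sum.inr y)).isLt
    have h2 := hr y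
    have h3 := Fintype.card_sum (α := α) (β := β)
    omega
  have hσ : Function.Injective fun x => (⟨ρ (Sum.inl x), hl x⟩ : Fin (Fintype.card α)) := by
    intro x x' h
    exact Sum.inl_injective (ρ.injective (Fin.ext (Fin.mk.inj h)))
  have hτ : Function.Injective fun y =>
      (⟨ρ (Sum.inr y) - Fintype.card α, hr' y⟩ : Fin (Fintype.card β)) := by
    intro y y' h
    have h1 := Fin.mk.inj h
    have h2 := hr y
    have h3 := hr y'
    exact Sum.inr_injective (ρ.injective (Fin.ext (by omega)))
  refine ⟨(Equiv.ofBijective _ ((Fintype.bijective_iff_injective_and_card _).2 ⟨hσ, by simp⟩),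
    Equiv.ofBijective _ ((Fintype.bijective_iff_injective_and_card _).2 ⟨hτ, by simp⟩)), ?_, ?_⟩
  · simp only [linExts, mem_product, mem_filter, mem_univ, true_and]
    refine ⟨fun i j hij => ?_, fun i j hij => ?_⟩
    · exact hρ (Sum.inl i) (Sum.inl j) hij
    · exact Nat.sub_le_sub_right (hρ (Sum.inr i) (Sum.inr j) hij) _
  · refine Equiv.ext fun z => Fin.ext ?_
    rcases z with x | y
    · rw [concatLabelling_inl]
      rfl
    · rw [concatLabelling_inr]
      exact Nat.add_sub_cancel' (hr y)

theorem dN_concatLabelling_inl (r : α → α → Prop) (s : β → β → Prop)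
    (p : (α ≃ Fin (Fintype.card α)) × (β ≃ Fin (Fintype.card β))) (x : α) :
    dN (seriesComp r s) (concatLabelling p) (Sum.inl x) = dN r p.1 x := by
  simp [dN, concatLabelling_inl, seriesComp]

theorem dN_concatLabelling_inr (r : α → α → Prop) (s : β → β → Prop)
    (p : (α ≃ Fin (Fintype.card α)) × (β ≃ Fin (Fintype.card β))) (y : β) :
    dN (seriesComp r s) (concatLabelling p) (Sum.inr y) = dN s p.2 y := by
  rcases isEmpty_or_nonempty α with hα | ⟨⟨a⟩⟩
  · simp [dN, concatLabelling_inr, seriesComp]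
  have hcard : 0 < Fintype.card α := Fintype.card_pos_iff.2 ⟨a⟩
  have hlast : ((p.1 (p.1.symm ⟨Fintype.card α - 1, by omega⟩) : Fin _) : ℕ) =
      Fintype.card α - 1 := by simp
  have hne : ¬ ∀ j : α ⊕ β, seriesComp r s j (Sum.inr y) → j = Sum.inr y := fun h => by
    simpa using h (Sum.inl a) trivial
  rw [dN, dN, if_neg hne]
  split_ifs with hmin
  · refine IsLeast.csInf_eq ⟨⟨Sum.inl (p.1.symm ⟨Fintype.card α - 1, by omega⟩), by simp,
      trivial, ?_⟩, ?_⟩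
    · rw [concatLabelling_inl, concatLabelling_inr, hlast]
      omega
    · rintro m ⟨x | j, hj, hjy, rfl⟩
      · have := (p.1 x).isLt
        rw [concatLabelling_inl, concatLabelling_inr]
        omega
      · exact absurd (congrArg Sum.inr (hmin j hjy)) hj
  · push Not at hmin
    obtain ⟨j₀, hj₀, hne₀⟩ := hmin
    set S := {m : ℕ | ∃ j : β, j ≠ y ∧ s j y ∧ m = (p.2 y : ℕ) - (p.2 j : ℕ)}
    have hmem₀ : (p.2 y : ℕ) - (p.2 j₀ : ℕ) ∈ S := ⟨j₀, hne₀, hj₀, rfl⟩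
    refine IsLeast.csInf_eq ⟨?_, ?_⟩
    · obtain ⟨j, hj, hjy, hm⟩ := Nat.sInf_mem ⟨_, hmem₀⟩
      refine ⟨Sum.inr j, by simpa using hj, hjy, ?_⟩
      rw [concatLabelling_inr, concatLabelling_inr, hm]
      omega
    · rintro m ⟨x | j, hj, hjy, rfl⟩
      · have h1 := (p.1 x).isLt
        have h2 := Nat.sInf_le hmem₀
        rw [concatLabelling_inl, concatLabelling_inr]
        omega
      · refine Nat.sInf_le ⟨j, fun h => hj (congrArg Sum.inr h), hjy, ?_⟩
        rw [concatLabelling_inr, concatLabelling_inr]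
        omega

end Concat

/-- `QLB(P ⊕ Q) = QLB(P) + QLB(Q)` for the series composition. -/
theorem stmt_6 (α β : Type) [Fintype α] [Fintype β]
    (r : α → α → Prop) (s : β → β → Prop)
    [IsPartialOrder α r] [IsPartialOrder β s] :
    QLB (α ⊕ β) (seriesComp r s) = QLB α r + QLB β s := by
  have himage : linExts (α ⊕ β) (seriesComp r s) =
      (linExts α r ×ˢ linExts β s).map ⟨concatLabelling, concatLabelling_injective⟩ := by
    ext ρ
    simp only [mem_map, Function.Embedding.coeFn_mk]
    refine ⟨exists_concatLabelling_eq, ?_⟩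
    rintro ⟨p, hp, rfl⟩
    exact concatLabelling_mem_linExts hp
  have hα : ((linExts α r).card : ℝ) ≠ 0 := by
    exact_mod_cast (linExts_nonempty_s6 α r).card_pos.ne'
  have hβ : ((linExts β s).card : ℝ) ≠ 0 := by
    exact_mod_cast (linExts_nonempty_s6 β s).card_pos.ne'
  simp only [QLB, himage, sum_map, card_map, card_product, Function.Embedding.coeFn_mk,
    Fintype.sum_sum_type, dN_concatLabelling_inl, dN_concatLabelling_inr, sum_add_distrib,
    sum_product, sum_const, nsmul_eq_mul, Nat.cast_mul, ← mul_sum]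
  field_simp
end
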